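/- arXiv:1512.04988 — 4 statements merged into one kernel-verified Lean document; each statement's English description precedes it below -/
import Mathlib

section
/- Let γ be a probability measure on ℝ with γ ∈ 𝒯_q for some q > 2. Then for every w ∈ ℝ, 𝕀ᵃ_γ(w) = inf{ 𝕀^q_{γ,ν}(w) + H(ν|μ₂) + (1/2)(1 − m₂(ν)) : ν a probability measure on ℝ with m₂(ν) ≤ 1 }. In particular, 𝕀ᵃ_γ(w) ≤ 𝕀^q_{γ,μ₂}(w) for all w ∈ ℝ. -/
open MeasureTheory Filter Topology Set ProbabilityTheory
open scoped ENNReal NNReal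

noncomputable section

namespace LDP

/-- The nonnegative part of an extended real, as an extended nonnegative real. -/
def erealToENNReal (x : EReal) : ℝ≥0∞ := if x = ⊤ then ⊤ else ENNReal.ofReal x.toReal

/-- Extended (possibly infinite) integral of an `EReal`-valued function:
positive part minus negative part. -/
def eIntegral (ν : Measure ℝ) (f : ℝ → EReal) : EReal :=
  ((∫⁻ u, erealToENNReal (f u) ∂ν : ℝ≥0∞) : EReal)
    - ((∫⁻ u, erealToENNReal (-f u) ∂ν : ℝ≥0∞) : EReal)

/-- `q`-th absolute moment of a measure on `ℝ`. -/
def mom (q : ℝ) (ν : Measure ℝ) : ℝ≥0∞ := ∫⁻ x, ENNReal.ofReal (|x| ^ q) ∂ν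

open Classical in
/-- Relative entropy `H(ν|μ)`. -/
def relEnt (ν μ : Measure ℝ) : EReal :=
  if ν ≪ μ then eIntegral ν (fun x => ENNReal.log (ν.rnDeriv μ x)) else ⊤

/-- The generalized normal distribution `μ_p` on `ℝ`. -/
def muP (p : ℝ) : Measure ℝ :=
  volume.withDensity fun y =>
    ENNReal.ofReal ((2 * p ^ (1/p) * Real.Gamma (1 + 1/p))⁻¹ * Real.exp (-(|y| ^ p) / p))

/-- The uniform probability measure `μ_∞` on `[-1,1]`. -/
def muInf : Measure ℝ := (volume (Icc (-1:ℝ) 1))⁻¹ • volume.restrict (Icc (-1:ℝ) 1)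

/-- Extended-real-valued log moment generating function of a measure on `ℝ`. -/
def logM (γ : Measure ℝ) (t : ℝ) : EReal :=
  ENNReal.log (∫⁻ y, ENNReal.ofReal (Real.exp (t * y)) ∂γ)

/-- The class `𝒯_q` of measures whose log mgf is dominated by `C|t|^{q/(q-1)} + C`. -/
def memT (q : ℝ) (γ : Measure ℝ) : Prop :=
  ∃ C : ℝ, ∀ t : ℝ, logM γ t ≤ ((C * |t| ^ (q/(q-1)) + C : ℝ) : EReal)

/-- Legendre transform of a function of one real variable. -/
def legendre1 (Λ : ℝ → EReal) (τ : ℝ) : EReal := ⨆ t : ℝ, ((t * τ : ℝ) : EReal) - Λ t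

/-- Legendre transform of a function of two real variables. -/
def legendre2 (Λ : ℝ × ℝ → EReal) (τ : ℝ × ℝ) : EReal :=
  ⨆ t : ℝ × ℝ, ((t.1 * τ.1 + t.2 * τ.2 : ℝ) : EReal) - Λ t

/-- Legendre transform of a function of three real variables. -/
def legendre3 (Λ : ℝ × ℝ × ℝ → EReal) (τ : ℝ × ℝ × ℝ) : EReal :=
  ⨆ t : ℝ × ℝ × ℝ, ((t.1 * τ.1 + t.2.1 * τ.2.1 + t.2.2 * τ.2.2 : ℝ) : EReal) - Λ t

/-- `Φ_p(t₀,t₁,t₂) = log ∫∫ exp(t₀ z² + t₁ z y + t₂ |y|^p) μ₂(dz) μ_p(dy)`. -/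
def Phi (p : ℝ) (t : ℝ × ℝ × ℝ) : EReal :=
  ENNReal.log (∫⁻ y, (∫⁻ z,
    ENNReal.ofReal (Real.exp (t.1 * z^2 + t.2.1 * z * y + t.2.2 * |y| ^ p)) ∂(muP 2)) ∂(muP p))

/-- The annealed rate function `𝕀ᵃ_p` for `p ∈ [2,∞)`. -/
def Ia (p : ℝ) (w : ℝ) : EReal :=
  ⨅ τ ∈ {τ : ℝ × ℝ × ℝ | 0 < τ.1 ∧ 0 < τ.2.2 ∧
      τ.1 ^ (-(1:ℝ)/2) * τ.2.1 * τ.2.2 ^ (-(1:ℝ)/p) = w},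
    legendre3 (Phi p) τ

/-- `Λ_p(t₁,t₂) = log ∫ exp(t₁ y + t₂|y|^p) μ_p(dy)`. -/
def LamP (p : ℝ) (t : ℝ × ℝ) : EReal :=
  ENNReal.log (∫⁻ y, ENNReal.ofReal (Real.exp (t.1 * y + t.2 * |y| ^ p)) ∂(muP p))

/-- `Ψ_{p,ν}(t₁,t₂) = ∫ Λ_p(t₁ u, t₂) ν(du)`. -/
def Psi (p : ℝ) (ν : Measure ℝ) (t : ℝ × ℝ) : EReal :=
  eIntegral ν (fun u => LamP p (t.1 * u, t.2))

/-- The quenched rate function `𝕀^q_{p,ν}`. -/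
def Iq (p : ℝ) (ν : Measure ℝ) (w : ℝ) : EReal :=
  ⨅ τ ∈ {τ : ℝ × ℝ | 0 < τ.2 ∧ τ.1 * τ.2 ^ (-(1:ℝ)/p) = w}, legendre2 (Psi p ν) τ

/-- The Cramér-type rate function `𝕀^{cr}_p`. -/
def Icr (p : ℝ) (w : ℝ) : EReal :=
  ⨅ τ ∈ {τ : ℝ × ℝ | 0 < τ.2 ∧ τ.1 * τ.2 ^ (-(1:ℝ)/p) = w}, legendre2 (LamP p) τ

/-- `Φ_γ(t₀,t₁) = log ∫∫ exp(t₀ z² + t₁ z x) μ₂(dz) γ(dx)`. -/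
def Phig (γ : Measure ℝ) (t : ℝ × ℝ) : EReal :=
  ENNReal.log (∫⁻ x, (∫⁻ z,
    ENNReal.ofReal (Real.exp (t.1 * z^2 + t.2 * z * x)) ∂(muP 2)) ∂γ)

/-- The annealed rate function `𝕀ᵃ_γ` for a product measure `γ^{⊗n}`. -/
def Iag (γ : Measure ℝ) (w : ℝ) : EReal :=
  ⨅ τ ∈ {τ : ℝ × ℝ | 0 < τ.1 ∧ τ.1 ^ (-(1:ℝ)/2) * τ.2 = w}, legendre2 (Phig γ) τ

/-- `Ψ_{γ,ν}(t) = ∫ log M_γ(t u) ν(du)`. -/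
def Psig (γ ν : Measure ℝ) (t : ℝ) : EReal := eIntegral ν (fun u => logM γ (t * u))

/-- The quenched rate function `𝕀^q_{γ,ν}` for a product measure. -/
def Iqg (γ ν : Measure ℝ) : ℝ → EReal := legendre1 (Psig γ ν)

/-- `Ψ_{∞,ν}`. -/
def PsiInf (ν : Measure ℝ) : ℝ → EReal := Psig muInf ν

/-- `𝕀^q_{∞,ν}`. -/
def IqInf (ν : Measure ℝ) : ℝ → EReal := legendre1 (PsiInf ν)

/-- `𝕀ᵃ_∞`. -/
def IaInf : ℝ → EReal := Iag muInf

/-- Euclidean inner product on `ℝⁿ`. -/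
def dotp {n : ℕ} (x y : Fin n → ℝ) : ℝ := ∑ i, x i * y i

/-- The unit ℓ^p ball of `ℝⁿ`. -/
def lpBall (n : ℕ) (p : ℝ) : Set (Fin n → ℝ) := {x | ∑ i, |x i| ^ p ≤ 1}

/-- The uniform probability measure on the unit ℓ^p ball. -/
def uniformLpBall (n : ℕ) (p : ℝ) : Measure (Fin n → ℝ) :=
  (volume (lpBall n p))⁻¹ • volume.restrict (lpBall n p)

/-- The unit Euclidean sphere in `ℝⁿ`. -/
def unitSphereSet (n : ℕ) : Set (Fin n → ℝ) := {x | ∑ i, (x i)^2 = 1}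

/-- `μ` is the (unique) rotation-invariant probability measure on the unit sphere `S^{n-1}`. -/
def IsUniformSphere {n : ℕ} (μ : Measure (Fin n → ℝ)) : Prop :=
  IsProbabilityMeasure μ ∧ μ (unitSphereSet n) = 1 ∧
    ∀ O : Matrix.orthogonalGroup (Fin n) ℝ,
      Measure.map (fun x => (O : Matrix (Fin n) (Fin n) ℝ).mulVec x) μ = μ

/-- A large deviation principle with speed `s` and rate function `I`. -/
def IsLDP {Ω : Type*} [MeasurableSpace Ω] (P : Measure Ω)
    (ξ : ℕ → Ω → ℝ) (s : ℕ → ℝ) (I : ℝ → EReal) : Prop :=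
  LowerSemicontinuous I ∧
    ∀ Γ : Set ℝ, MeasurableSet Γ →
      (-(⨅ x ∈ interior Γ, I x) ≤
        atTop.liminf fun n =>
          (((s n)⁻¹ : ℝ) : EReal) * ENNReal.log (P {ω | ξ n ω ∈ interior Γ})) ∧
      ((atTop.limsup fun n =>
          (((s n)⁻¹ : ℝ) : EReal) * ENNReal.log (P {ω | ξ n ω ∈ closure Γ})) ≤
        -(⨅ x ∈ closure Γ, I x))

/-- Goodness of a rate function: compact sublevel sets. -/
def HasCompactSublevels (I : ℝ → EReal) : Prop := ∀ c : ℝ, IsCompact {x | I x ≤ (c : EReal)}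

/-- Quasiconvexity: convex sublevel sets. -/
def QuasiconvexRate (I : ℝ → EReal) : Prop := ∀ c : EReal, Convex ℝ {x | I x ≤ c}

/-- Symmetry: `I(-w) = I(w)`. -/
def SymmetricRate (I : ℝ → EReal) : Prop := ∀ w : ℝ, I (-w) = I w

/-- Convexity of an extended-real-valued rate function. -/
def ConvexRate (I : ℝ → EReal) : Prop :=
  ∀ x y a b : ℝ, 0 ≤ a → 0 ≤ b → a + b = 1 →
    I (a * x + b * y) ≤ (a : EReal) * I x + (b : EReal) * I y

/-- Convexity on a set, for extended-real-valued functions. -/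
def ConvexOnE (s : Set ℝ) (g : ℝ → EReal) : Prop :=
  ∀ x ∈ s, ∀ y ∈ s, ∀ a b : ℝ, 0 ≤ a → 0 ≤ b → a + b = 1 →
    g (a * x + b * y) ≤ (a : EReal) * g x + (b : EReal) * g y

/-- Concavity on a set, for extended-real-valued functions. -/
def ConcaveOnE (s : Set ℝ) (g : ℝ → EReal) : Prop :=
  ∀ x ∈ s, ∀ y ∈ s, ∀ a b : ℝ, 0 ≤ a → 0 ≤ b → a + b = 1 →
    (a : EReal) * g x + (b : EReal) * g y ≤ g (a * x + b * y)

/-- Strict convexity, for extended-real-valued functions. -/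
def StrictConvexE (g : ℝ → EReal) : Prop :=
  ∀ x y : ℝ, x ≠ y → ∀ a b : ℝ, 0 < a → 0 < b → a + b = 1 →
    g (a * x + b * y) < (a : EReal) * g x + (b : EReal) * g y

/-- The property of agreeing with a real affine function on a set. -/
def AffineOnE (s : Set ℝ) (g : ℝ → EReal) : Prop :=
  ∃ m q : ℝ, ∀ t ∈ s, g t = ((m * t + q : ℝ) : EReal)

/-- Empirical measure `L_{n,θ} = (1/n) Σ δ_{√n θ_i}`. -/
def empMeas (n : ℕ) (θn : Fin n → ℝ) : Measure ℝ :=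
  ((n : ℝ≥0∞))⁻¹ • ∑ i : Fin n, Measure.dirac (Real.sqrt n * θn i)

end LDP

open LDP

namespace LDP

lemma eIntegral_eq_integral {ν : Measure ℝ} {f : ℝ → EReal} {g : ℝ → ℝ}
    (hfg : ∀ᵐ x ∂ν, f x = (g x : EReal)) (hg : Integrable g ν) :
    eIntegral ν f = ((∫ x, g x ∂ν : ℝ) : EReal) := by
  have hp : ∫⁻ u, erealToENNReal (f u) ∂ν = ∫⁻ u, ENNReal.ofReal (g u) ∂ν := by
    refine lintegral_congr_ae ?_
    filter_upwards [hfg] with x hx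
    simp [hx, erealToENNReal]
  have hn : ∫⁻ u, erealToENNReal (-f u) ∂ν = ∫⁻ u, ENNReal.ofReal (-g u) ∂ν := by
    refine lintegral_congr_ae ?_
    filter_upwards [hfg] with x hx
    rw [hx, ← EReal.coe_neg]
    simp [erealToENNReal, -EReal.coe_neg]
  rw [eIntegral, hp, hn, integral_eq_lintegral_pos_part_sub_lintegral_neg_part hg, EReal.coe_sub,
    EReal.coe_ennreal_toReal hg.lintegral_lt_top.ne,
    EReal.coe_ennreal_toReal (x := ∫⁻ u, ENNReal.ofReal (-g u) ∂ν) hg.neg.lintegral_lt_top.ne]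

lemma muP_two : muP 2 = gaussianReal 0 1 := by
  rw [gaussianReal_of_var_ne_zero _ one_ne_zero, muP]
  congr 1
  ext y
  rw [gaussianPDF, gaussianPDFReal]
  have hΓ : Real.Gamma (1 + 1 / 2) = √Real.pi / 2 := by
    rw [add_comm, Real.Gamma_add_one (by norm_num), Real.Gamma_one_half_eq]
    ring
  have h2 : (2 : ℝ) ^ (1 / 2 : ℝ) = √2 := (Real.sqrt_eq_rpow 2).symm
  rw [hΓ, h2, Real.rpow_two, sq_abs]
  congr 2
  · simp
    ring
  · simp

lemma ae_log_rnDeriv_eq_llr {ν μ : Measure ℝ} [SigmaFinite ν] [SigmaFinite μ] (h : ν ≪ μ) :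
    ∀ᵐ x ∂ν, ENNReal.log (ν.rnDeriv μ x) = (llr ν μ x : EReal) := by
  filter_upwards [Measure.rnDeriv_pos h, h (Measure.rnDeriv_lt_top ν μ)] with x h0 h1
  exact ENNReal.log_pos_real h0.ne' h1.ne

lemma relEnt_eq_integral_llr {ν μ : Measure ℝ} [SigmaFinite ν] [SigmaFinite μ] (h : ν ≪ μ)
    (hi : Integrable (llr ν μ) ν) : relEnt ν μ = ((∫ x, llr ν μ x ∂ν : ℝ) : EReal) := by
  rw [relEnt, if_pos h]
  exact eIntegral_eq_integral (ae_log_rnDeriv_eq_llr h) hi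

lemma lintegral_neg_llr_lt_top {ν μ : Measure ℝ} [IsFiniteMeasure ν] [IsFiniteMeasure μ]
    (h : ν ≪ μ) : ∫⁻ x, ENNReal.ofReal (-llr ν μ x) ∂ν < ⊤ := by
  rw [← lintegral_rnDeriv_mul (f := fun x => ENNReal.ofReal (-llr ν μ x)) h
    (measurable_llr ν μ).neg.ennreal_ofReal.aemeasurable]
  refine (lintegral_mono_ae (g := fun _ => 1) ?_).trans_lt (by simp)
  filter_upwards [Measure.rnDeriv_lt_top ν μ] with x hx
  rw [llr_def]
  set r := ν.rnDeriv μ x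
  rw [← ENNReal.ofReal_toReal hx.ne, ← ENNReal.ofReal_mul ENNReal.toReal_nonneg,
    ENNReal.ofReal_le_one]
  beta_reduce
  have := InformationTheory.klFun_nonneg (x := r.toReal) ENNReal.toReal_nonneg
  rw [InformationTheory.klFun] at this
  nlinarith [ENNReal.toReal_nonneg (a := r)]

lemma relEnt_eq_top {ν μ : Measure ℝ} [IsFiniteMeasure ν] [IsFiniteMeasure μ]
    (h : ¬(ν ≪ μ ∧ Integrable (llr ν μ) ν)) : relEnt ν μ = ⊤ := by
  by_cases hac : ν ≪ μ
  swap
  · rw [relEnt, if_neg hac]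
  have hi : ¬ Integrable (llr ν μ) ν := fun hi => h ⟨hac, hi⟩
  have hp : ∫⁻ u, erealToENNReal (ENNReal.log (ν.rnDeriv μ u)) ∂ν
      = ∫⁻ u, ENNReal.ofReal (llr ν μ u) ∂ν := by
    refine lintegral_congr_ae ?_
    filter_upwards [ae_log_rnDeriv_eq_llr hac] with x hx
    simp [hx, erealToENNReal]
  have hn : ∫⁻ u, erealToENNReal (-ENNReal.log (ν.rnDeriv μ u)) ∂ν
      = ∫⁻ u, ENNReal.ofReal (-llr ν μ u) ∂ν := by
    refine lintegral_congr_ae ?_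
    filter_upwards [ae_log_rnDeriv_eq_llr hac] with x hx
    rw [hx, ← EReal.coe_neg]
    simp [erealToENNReal, -EReal.coe_neg]
  have htop : ∫⁻ u, ENNReal.ofReal (llr ν μ u) ∂ν = ⊤ := by
    by_contra hne
    refine hi ⟨(measurable_llr ν μ).aestronglyMeasurable, ?_⟩
    rw [hasFiniteIntegral_iff_norm]
    have hsum : ∀ x, ENNReal.ofReal ‖llr ν μ x‖
        = ENNReal.ofReal (llr ν μ x) + ENNReal.ofReal (-llr ν μ x) := by
      intro x
      rcases le_total 0 (llr ν μ x) with h0 | h0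
      · rw [Real.norm_of_nonneg h0, ENNReal.ofReal_of_nonpos (neg_nonpos.2 h0), add_zero]
      · rw [Real.norm_of_nonpos h0, ENNReal.ofReal_of_nonpos h0, zero_add]
    simp_rw [hsum]
    rw [lintegral_add_left (measurable_llr ν μ).ennreal_ofReal]
    exact ENNReal.add_lt_top.2 ⟨lt_top_iff_ne_top.2 hne, lintegral_neg_llr_lt_top hac⟩
  rw [relEnt, if_pos hac, eIntegral, hp, hn, htop,
    ← EReal.coe_ennreal_toReal (lintegral_neg_llr_lt_top hac).ne]
  rfl

/-- The Donsker–Varadhan inequality. -/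
lemma integral_sub_integral_llr_le {ν μ : Measure ℝ} [IsProbabilityMeasure ν]
    [IsProbabilityMeasure μ] {g : ℝ → ℝ} (h : ν ≪ μ) (hi : Integrable (llr ν μ) ν)
    (hg : Integrable g ν) (he : Integrable (fun x => Real.exp (g x)) μ) :
    ∫ x, g x ∂ν - ∫ x, llr ν μ x ∂ν ≤ Real.log (∫ x, Real.exp (g x) ∂μ) := by
  have := isProbabilityMeasure_tilted he
  have h0 := InformationTheory.integral_llr_add_sub_measure_univ_nonneg
    (h.trans (absolutelyContinuous_tilted he)) (integrable_llr_tilted_right h hg hi he)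
  rw [integral_llr_tilted_right h hg he hi] at h0
  simp only [probReal_univ] at h0
  linarith

/-- A convex function on `ℝ` that vanishes at `0` and is `o(y²)` at infinity. -/
structure IsSubquadratic (L : ℝ → ℝ) : Prop where
  convexOn : ConvexOn ℝ univ L
  map_zero : L 0 = 0
  exists_abs_le : ∀ δ > 0, ∃ K, 0 ≤ K ∧ ∀ y, |L y| ≤ δ * y ^ 2 + K

/-- The partition function `∫ exp(-s z² + L(t z)) dz`. -/
def partitionFn (L : ℝ → ℝ) (s t : ℝ) : ℝ := ∫ z, Real.exp (-s * z ^ 2 + L (t * z))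

namespace IsSubquadratic

variable {L : ℝ → ℝ}

lemma continuous (hL : IsSubquadratic L) : Continuous L :=
  continuousOn_univ.1 (hL.convexOn.continuousOn isOpen_univ)

lemma exists_le (hL : IsSubquadratic L) (t : ℝ) {δ : ℝ} (hδ : 0 < δ) :
    ∃ K, 0 ≤ K ∧ ∀ r z, |r| ≤ |t| → |L (r * z)| ≤ δ * z ^ 2 + K := by
  obtain ⟨K, hK0, hK⟩ := hL.exists_abs_le (δ / (t ^ 2 + 1)) (by positivity)
  refine ⟨K, hK0, fun r z hr => (hK _).trans ?_⟩
  refine add_le_add ?_ le_rfl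
  have h1 : r ^ 2 ≤ t ^ 2 := sq_le_sq.2 hr
  have : δ / (t ^ 2 + 1) * (r * z) ^ 2 = δ * z ^ 2 * (r ^ 2 / (t ^ 2 + 1)) := by ring
  rw [this]
  refine mul_le_of_le_one_right (by positivity) ?_
  rw [div_le_one (by positivity)]
  linarith

lemma integrable_exp (hL : IsSubquadratic L) {s : ℝ} (hs : 0 < s) (t : ℝ) :
    Integrable fun z => Real.exp (-s * z ^ 2 + L (t * z)) := by
  obtain ⟨K, -, hK⟩ := hL.exists_le t (half_pos hs)
  have hc := hL.continuous
  refine ((integrable_exp_neg_mul_sq (half_pos hs)).mul_const (Real.exp K)).mono'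
    (by fun_prop) (ae_of_all _ fun z => ?_)
  rw [Real.norm_of_nonneg (Real.exp_nonneg _), ← Real.exp_add, Real.exp_le_exp]
  linarith [(abs_le.1 (hK t z le_rfl)).2]

lemma partitionFn_pos (hL : IsSubquadratic L) {s : ℝ} (hs : 0 < s) (t : ℝ) :
    0 < partitionFn L s t :=
  integral_exp_pos (hL.integrable_exp hs t)

lemma partitionFn_zero (hL : IsSubquadratic L) (s : ℝ) :
    partitionFn L s 0 = √(Real.pi / s) := by
  simp_rw [partitionFn, zero_mul, hL.map_zero, add_zero, integral_gaussian]

lemma continuousOn_partitionFn (hL : IsSubquadratic L) :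
    ContinuousOn (fun x : ℝ × ℝ => partitionFn L x.1 x.2) {x | 0 < x.1} := by
  rintro ⟨s, t⟩ hs
  change 0 < s at hs
  obtain ⟨K, -, hK⟩ := hL.exists_le (|t| + 1) (δ := s / 4) (by positivity)
  have hc := hL.continuous
  refine ContinuousAt.continuousWithinAt ?_
  have hnhds : ∀ᶠ x : ℝ × ℝ in 𝓝 (s, t), s / 2 < x.1 ∧ |x.2| < |t| + 1 := by
    refine (IsOpen.eventually_mem (s := {x : ℝ × ℝ | s / 2 < x.1 ∧ |x.2| < |t| + 1}) ?_
      ⟨by simp; linarith, by simp⟩)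
    exact (isOpen_lt continuous_const continuous_fst).inter
      (isOpen_lt continuous_snd.abs continuous_const)
  unfold partitionFn
  refine continuousAt_of_dominated (bound := fun z => Real.exp (-(s / 4) * z ^ 2) * Real.exp K)
    (Eventually.of_forall fun x => by fun_prop) ?_
    ((integrable_exp_neg_mul_sq (by positivity)).mul_const _)
    (ae_of_all _ fun z => by fun_prop)
  filter_upwards [hnhds] with x hx
  refine ae_of_all _ fun z => ?_
  rw [Real.norm_of_nonneg (Real.exp_nonneg _), ← Real.exp_add, Real.exp_le_exp]
  have h1 := (abs_le.1 (hK x.2 z (hx.2.le.trans (le_abs_self _)))).2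
  nlinarith [mul_nonneg (sub_nonneg.2 hx.1.le) (sq_nonneg z)]

lemma _root_.LDP.partitionFn_neg (L : ℝ → ℝ) (s t : ℝ) :
    partitionFn L s (-t) = partitionFn L s t := by
  rw [partitionFn, ← integral_neg_eq_self, partitionFn]
  simp

lemma _root_.LDP.partitionFn_scale (L : ℝ → ℝ) (s t : ℝ) {c : ℝ} (hc : 0 < c) :
    partitionFn L (s * c ^ 2) (t * c) = c⁻¹ * partitionFn L s t := by
  have := Measure.integral_comp_mul_left (fun z => Real.exp (-s * z ^ 2 + L (t * z))) c
  rw [abs_of_pos (inv_pos.2 hc), smul_eq_mul] at this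
  rw [partitionFn, partitionFn, ← this]
  congr 1 with z
  ring_nf

lemma le_partitionFn_of_nonneg (hL : IsSubquadratic L) {s t a b : ℝ} (hs : 0 < s) (ht : 0 ≤ t)
    (ha : 0 ≤ a) (h : ∀ y, 0 ≤ y → a * y - b ≤ L y) :
    (√s)⁻¹ * Real.exp (a ^ 2 * t ^ 2 / (4 * s) - 1 - b) ≤ partitionFn L s t := by
  have hi := hL.integrable_exp hs t
  set z₀ := a * t / (2 * s) with hz₀
  have hz₀' : 0 ≤ z₀ := by positivity
  have hss : 0 < √s := Real.sqrt_pos.2 hs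
  have hvol : volume.real (Icc z₀ (z₀ + (√s)⁻¹)) = (√s)⁻¹ := by
    rw [Real.volume_real_Icc_of_le (by simp)]
    ring
  calc (√s)⁻¹ * Real.exp (a ^ 2 * t ^ 2 / (4 * s) - 1 - b)
      = ∫ _ in Icc z₀ (z₀ + (√s)⁻¹), Real.exp (a ^ 2 * t ^ 2 / (4 * s) - 1 - b) := by
        rw [setIntegral_const, hvol, smul_eq_mul]
    _ ≤ ∫ z in Icc z₀ (z₀ + (√s)⁻¹), Real.exp (-s * z ^ 2 + L (t * z)) := by
        refine setIntegral_mono_on (by simp) hi.integrableOn measurableSet_Icc ?_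
        intro z hz
        rw [Real.exp_le_exp]
        have h1 := h (t * z) (mul_nonneg ht (hz₀'.trans hz.1))
        have h2 : s * (z - z₀) ^ 2 ≤ 1 := by
          have : (z - z₀) ^ 2 ≤ ((√s)⁻¹) ^ 2 :=
            pow_le_pow_left₀ (by linarith [hz.1]) (by linarith [hz.2]) 2
          rw [inv_pow, Real.sq_sqrt hs.le] at this
          calc s * (z - z₀) ^ 2 ≤ s * s⁻¹ := by gcongr
            _ = 1 := mul_inv_cancel₀ hs.ne'
        have h3 : -s * z ^ 2 + a * (t * z) = a ^ 2 * t ^ 2 / (4 * s) - s * (z - z₀) ^ 2 := by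
          rw [hz₀]
          field_simp
          ring
        linarith
    _ ≤ partitionFn L s t :=
        setIntegral_le_integral hi (ae_of_all _ fun _ => Real.exp_nonneg _)

lemma comp_neg (hL : IsSubquadratic L) : IsSubquadratic fun y => L (-y) where
  convexOn := by
    refine ⟨convex_univ, fun x _ y _ a b ha hb hab => ?_⟩
    have := hL.convexOn.2 (mem_univ (-x)) (mem_univ (-y)) ha hb hab
    simp only [smul_eq_mul] at this ⊢
    convert this using 2
    ring
  map_zero := by simp [hL.map_zero]
  exists_abs_le := fun δ hδ => by
    obtain ⟨K, hK0, hK⟩ := hL.exists_abs_le δ hδ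
    exact ⟨K, hK0, fun y => by simpa using hK (-y)⟩

lemma le_partitionFn (hL : IsSubquadratic L) {s t a b : ℝ} (hs : 0 < s) (ha : 0 ≤ a)
    (h : (∀ y, 0 ≤ y → a * y - b ≤ L y) ∨ ∀ y, 0 ≤ y → a * y - b ≤ L (-y)) :
    (√s)⁻¹ * Real.exp (a ^ 2 * t ^ 2 / (4 * s) - 1 - b) ≤ partitionFn L s t := by
  have habs : partitionFn L s |t| = partitionFn L s t := by
    rcases abs_choice t with h | h <;> rw [h]
    exact partitionFn_neg L s t
  rw [← sq_abs t]
  rcases h with h | h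
  · rw [← habs]
    exact hL.le_partitionFn_of_nonneg hs (abs_nonneg t) ha h
  · refine (hL.comp_neg.le_partitionFn_of_nonneg hs (abs_nonneg t) ha h).trans_eq ?_
    rw [← habs, ← partitionFn_neg]
    simp [partitionFn]

lemma partitionFn_le (hL : IsSubquadratic L) {s w : ℝ} (hs : 0 < s) (hw : w ≠ 0)
    (h : ∀ y, L y ≤ |w| * |y|) :
    partitionFn L s (2 * s / w) ≤ 2 * Real.exp s * √(Real.pi / s) := by
  have hg (c : ℝ) : Integrable fun z : ℝ => Real.exp (-s * (z - c) ^ 2) :=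
    (integrable_exp_neg_mul_sq hs).comp_sub_right c
  have hgi (c : ℝ) : ∫ z : ℝ, Real.exp (-s * (z - c) ^ 2) = √(Real.pi / s) := by
    rw [integral_sub_right_eq_self (fun z : ℝ => Real.exp (-s * z ^ 2)) c, integral_gaussian]
  calc partitionFn L s (2 * s / w)
      ≤ ∫ z : ℝ, Real.exp s * (Real.exp (-s * (z - 1) ^ 2) + Real.exp (-s * (z - (-1)) ^ 2)) := by
        refine integral_mono (hL.integrable_exp hs _) (((hg 1).add (hg (-1))).const_mul _) ?_
        intro z
        have h1 := h (2 * s / w * z)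
        have h2 : |w| * |2 * s / w * z| = 2 * s * |z| := by
          rw [abs_mul, abs_div, abs_of_pos (by positivity : 0 < 2 * s)]
          field_simp
        beta_reduce
        rw [mul_add, ← Real.exp_add, ← Real.exp_add]
        rcases abs_choice z with h3 | h3
        · refine le_add_of_le_of_nonneg (Real.exp_le_exp.2 ?_) (Real.exp_nonneg _)
          rw [h2, h3] at h1
          linarith
        · refine le_add_of_nonneg_of_le (Real.exp_nonneg _) (Real.exp_le_exp.2 ?_)
          rw [h2, h3] at h1
          linarith
    _ = 2 * Real.exp s * √(Real.pi / s) := by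
        rw [integral_const_mul, integral_add (hg 1) (hg (-1)), hgi, hgi]
        ring

end IsSubquadratic

lemma memT.integrable_exp {q : ℝ} {γ : Measure ℝ} (hγ : memT q γ) (t : ℝ) :
    Integrable (fun y => Real.exp (t * y)) γ := by
  obtain ⟨C, hC⟩ := hγ
  have h := (hC t).trans_lt (EReal.coe_lt_top _)
  rw [logM, ENNReal.log_lt_top_iff] at h
  refine ⟨by fun_prop, ?_⟩
  rw [hasFiniteIntegral_iff_ofReal (ae_of_all _ fun _ => Real.exp_nonneg _)]
  exact h

lemma memT.lintegral_exp {q : ℝ} {γ : Measure ℝ} [IsProbabilityMeasure γ] (hγ : memT q γ) (t : ℝ) :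
    ∫⁻ y, ENNReal.ofReal (Real.exp (t * y)) ∂γ = ENNReal.ofReal (Real.exp (cgf id γ t)) := by
  rw [exp_cgf (X := id) (hγ.integrable_exp t)]
  exact (ofReal_integral_eq_lintegral_ofReal (hγ.integrable_exp t)
    (ae_of_all _ fun _ => Real.exp_nonneg _)).symm

lemma memT.logM_eq {q : ℝ} {γ : Measure ℝ} [IsProbabilityMeasure γ] (hγ : memT q γ) (t : ℝ) :
    logM γ t = (cgf id γ t : EReal) := by
  rw [logM, hγ.lintegral_exp, ENNReal.log_ofReal_of_pos (Real.exp_pos _), Real.log_exp]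

lemma convexOn_cgf_id {γ : Measure ℝ} [IsProbabilityMeasure γ]
    (h : ∀ t, Integrable (fun y => Real.exp (t * y)) γ) : ConvexOn ℝ univ (cgf id γ) := by
  refine ⟨convex_univ, fun x _ y _ a b ha hb hab => ?_⟩
  have hn (x : ℝ) : ∫ z, Real.exp (x * z - cgf id γ x) ∂γ = 1 := by
    simp_rw [Real.exp_sub]
    rw [integral_div, exp_cgf (X := id) (h x)]
    exact div_self (mgf_pos (h x)).ne'
  have hi (x : ℝ) : Integrable (fun z => Real.exp (x * z - cgf id γ x)) γ := by
    simp_rw [Real.exp_sub]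
    exact (h x).div_const _
  simp only [smul_eq_mul]
  set m := a * cgf id γ x + b * cgf id γ y with hm
  have hle : ∫ z, Real.exp ((a * x + b * y) * z - m) ∂γ ≤ 1 := by
    calc ∫ z, Real.exp ((a * x + b * y) * z - m) ∂γ
        ≤ ∫ z, a * Real.exp (x * z - cgf id γ x) + b * Real.exp (y * z - cgf id γ y) ∂γ := by
          refine integral_mono ?_ (((hi x).const_mul a).add ((hi y).const_mul b)) fun z => ?_
          · simp_rw [Real.exp_sub]
            exact (h _).div_const _
          · have := convexOn_exp.2 (mem_univ (x * z - cgf id γ x))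
              (mem_univ (y * z - cgf id γ y)) ha hb hab
            simp only [smul_eq_mul] at this
            refine le_trans (le_of_eq ?_) this
            congr 1
            rw [hm]
            ring
      _ = 1 := by
          rw [integral_add ((hi x).const_mul a) ((hi y).const_mul b), integral_const_mul,
            integral_const_mul, hn, hn, mul_one, mul_one, hab]
  have heq : ∫ z, Real.exp ((a * x + b * y) * z - m) ∂γ
      = Real.exp (cgf id γ (a * x + b * y) - m) := by
    simp_rw [Real.exp_sub]
    rw [integral_div, exp_cgf (X := id) (h _)]
    rfl
  rw [heq, Real.exp_le_one_iff] at hle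
  linarith

lemma exists_mul_rpow_le {p δ : ℝ} (hp0 : 0 ≤ p) (hp : p < 2) (hδ : 0 < δ) {C : ℝ} (hC : 0 ≤ C) :
    ∃ K, 0 ≤ K ∧ ∀ r, 0 ≤ r → C * r ^ p ≤ δ * r ^ 2 + K := by
  have h := ((tendsto_rpow_neg_atTop (sub_pos.2 hp)).const_mul C).eventually_le_const
    (u := δ) (by simpa using hδ)
  obtain ⟨R, hR⟩ := (h.and (eventually_gt_atTop 0)).exists_forall_of_atTop
  refine ⟨C * |R| ^ p, by positivity, fun r hr => ?_⟩
  rcases le_total R r with hRr | hRr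
  · obtain ⟨h1, h0⟩ := hR r hRr
    have h2 : C * r ^ p = C * r ^ (-(2 - p)) * r ^ 2 := by
      rw [mul_assoc, ← Real.rpow_two, ← Real.rpow_add h0]
      ring_nf
    have h3 : 0 ≤ C * |R| ^ p := by positivity
    rw [h2]
    nlinarith [sq_nonneg r]
  · have h3 : C * r ^ p ≤ C * |R| ^ p := by
      gcongr
      exact hRr.trans (le_abs_self R)
    nlinarith [sq_nonneg r]

lemma memT.isSubquadratic {q : ℝ} {γ : Measure ℝ} [IsProbabilityMeasure γ] (hq : 2 < q)
    (hγ : memT q γ) : IsSubquadratic (cgf id γ) where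
  convexOn := convexOn_cgf_id hγ.integrable_exp
  map_zero := cgf_zero
  exists_abs_le := fun δ hδ => by
    have hγ' := hγ
    obtain ⟨C, hC⟩ := hγ'
    have hp : q / (q - 1) < 2 := by
      rw [div_lt_iff₀ (by linarith)]
      linarith
    have hp0 : 0 ≤ q / (q - 1) := div_nonneg (by linarith) (by linarith)
    obtain ⟨K, hK0, hK⟩ := exists_mul_rpow_le hp0 hp hδ (abs_nonneg C)
    have hup (y : ℝ) : cgf id γ y ≤ δ * y ^ 2 + (K + |C|) := by
      have h := hC y
      rw [hγ.logM_eq, EReal.coe_le_coe_iff] at h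
      have h1 := hK |y| (abs_nonneg y)
      rw [sq_abs] at h1
      have h2 : C * |y| ^ (q / (q - 1)) ≤ |C| * |y| ^ (q / (q - 1)) := by
        gcongr
        exact le_abs_self C
      linarith [le_abs_self C]
    refine ⟨K + |C|, by positivity, fun y => abs_le.2 ⟨?_, hup y⟩⟩
    have hcv := (convexOn_cgf_id hγ.integrable_exp).2 (mem_univ y) (mem_univ (-y))
      (by norm_num : (0 : ℝ) ≤ 1 / 2) (by norm_num : (0 : ℝ) ≤ 1 / 2) (by norm_num)
    have h0 : (1 / 2 : ℝ) • y + (1 / 2 : ℝ) • (-y) = 0 := by simp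
    rw [h0, cgf_zero, smul_eq_mul, smul_eq_mul] at hcv
    have := hup (-y)
    rw [neg_sq] at this
    linarith

lemma Phig_eq_log_lintegral {q : ℝ} {γ : Measure ℝ} [IsProbabilityMeasure γ] (hγ : memT q γ)
    (a t : ℝ) :
    Phig γ (a, t) = ENNReal.log
      (∫⁻ z, ENNReal.ofReal (Real.exp (a * z ^ 2 + cgf id γ (t * z))) ∂gaussianReal 0 1) := by
  rw [Phig, muP_two, lintegral_lintegral_swap (by fun_prop)]
  congr 1
  refine lintegral_congr fun z => ?_
  rw [Real.exp_add, ENNReal.ofReal_mul (Real.exp_nonneg _), ← hγ.lintegral_exp,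
    ← lintegral_const_mul _ (by fun_prop)]
  refine lintegral_congr fun x => ?_
  rw [← ENNReal.ofReal_mul (Real.exp_nonneg _), ← Real.exp_add]

lemma gaussianPDFReal_zero_one (z : ℝ) :
    gaussianPDFReal 0 1 z = (√(2 * Real.pi))⁻¹ * Real.exp (-(1 / 2) * z ^ 2) := by
  simp only [gaussianPDFReal, NNReal.coe_one, mul_one, sub_zero]
  ring_nf

lemma integrable_gaussianReal_iff {f : ℝ → ℝ} :
    Integrable f (gaussianReal 0 1) ↔ Integrable fun z => Real.exp (-(1 / 2) * z ^ 2) * f z := by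
  rw [gaussianReal_of_var_ne_zero _ one_ne_zero, gaussianPDF_def,
    integrable_withDensity_iff_integrable_smul₀' (by fun_prop) (by simp)]
  have h (z : ℝ) : (ENNReal.ofReal (gaussianPDFReal 0 1 z)).toReal • f z
      = (√(2 * Real.pi))⁻¹ * (Real.exp (-(1 / 2) * z ^ 2) * f z) := by
    rw [ENNReal.toReal_ofReal (gaussianPDFReal_nonneg _ _ _), gaussianPDFReal_zero_one,
      smul_eq_mul, mul_assoc]
  simp_rw [h]
  exact integrable_const_mul_iff (by simp [Real.sqrt_eq_zero', Real.pi_pos]) _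

lemma integral_gaussianReal_eq (f : ℝ → ℝ) :
    ∫ z, f z ∂gaussianReal 0 1
      = (√(2 * Real.pi))⁻¹ * ∫ z, Real.exp (-(1 / 2) * z ^ 2) * f z := by
  rw [integral_gaussianReal_eq_integral_smul one_ne_zero, ← integral_const_mul]
  congr 1 with z
  rw [gaussianPDFReal_zero_one, smul_eq_mul, mul_assoc]

namespace IsSubquadratic

variable {L : ℝ → ℝ}

lemma integrable_exp_gaussianReal (hL : IsSubquadratic L) {s : ℝ} (hs : 0 < s) (t : ℝ) :
    Integrable (fun z => Real.exp ((1 / 2 - s) * z ^ 2 + L (t * z))) (gaussianReal 0 1) := by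
  rw [integrable_gaussianReal_iff]
  refine (hL.integrable_exp hs t).congr (ae_of_all _ fun z => ?_)
  beta_reduce
  rw [← Real.exp_add]
  ring_nf

lemma integral_exp_gaussianReal (L : ℝ → ℝ) (s t : ℝ) :
    ∫ z, Real.exp ((1 / 2 - s) * z ^ 2 + L (t * z)) ∂gaussianReal 0 1
      = (√(2 * Real.pi))⁻¹ * partitionFn L s t := by
  rw [integral_gaussianReal_eq, partitionFn]
  congr 2 with z
  rw [← Real.exp_add]
  ring_nf

lemma integrable_comp_mul (hL : IsSubquadratic L) {ν : Measure ℝ} [IsFiniteMeasure ν]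
    (hν : Integrable (fun x => x ^ 2) ν) (t : ℝ) : Integrable (fun z => L (t * z)) ν := by
  obtain ⟨K, -, hK⟩ := hL.exists_le t one_pos
  have hc := hL.continuous
  refine ((hν.const_mul 1).add (integrable_const K)).mono' (by fun_prop) (ae_of_all _ fun z => ?_)
  exact hK t z le_rfl

end IsSubquadratic

lemma Phig_eq_coe {q : ℝ} {γ : Measure ℝ} [IsProbabilityMeasure γ] (hq : 2 < q) (hγ : memT q γ)
    {s : ℝ} (hs : 0 < s) (t : ℝ) :
    Phig γ (1 / 2 - s, t) = ((Real.log
      (∫ z, Real.exp ((1 / 2 - s) * z ^ 2 + cgf id γ (t * z)) ∂gaussianReal 0 1) : ℝ) : EReal) := by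
  have hL := hγ.isSubquadratic hq
  rw [Phig_eq_log_lintegral hγ,
    ← ofReal_integral_eq_lintegral_ofReal (hL.integrable_exp_gaussianReal hs t)
      (ae_of_all _ fun _ => Real.exp_nonneg _),
    ENNReal.log_ofReal_of_pos (integral_exp_pos (hL.integrable_exp_gaussianReal hs t))]

lemma Phig_eq_top {γ : Measure ℝ} [IsProbabilityMeasure γ] {a : ℝ} (ha : 1 / 2 ≤ a) (t : ℝ) :
    Phig γ (a, t) = ⊤ := by
  rw [Phig, ENNReal.log_eq_top_iff, muP_two]
  have hx (x : ℝ) : ∫⁻ z, ENNReal.ofReal (Real.exp (a * z ^ 2 + t * z * x)) ∂gaussianReal 0 1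
      = ⊤ := by
    rw [← not_ne_iff, ← lt_top_iff_ne_top]
    intro h
    have hi : Integrable (fun z => Real.exp (a * z ^ 2 + t * z * x)) (gaussianReal 0 1) := by
      refine ⟨by fun_prop, ?_⟩
      rwa [hasFiniteIntegral_iff_ofReal (ae_of_all _ fun _ => Real.exp_nonneg _)]
    rw [integrable_gaussianReal_iff] at hi
    have h1 : Integrable fun z : ℝ => Real.exp (t * x * z) := by
      refine hi.mono' (by fun_prop) (ae_of_all _ fun z => ?_)
      rw [Real.norm_of_nonneg (Real.exp_nonneg _), ← Real.exp_add, Real.exp_le_exp]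
      nlinarith [sq_nonneg z]
    have h2 : Integrable fun _ : ℝ => (1 : ℝ) := by
      refine (h1.add h1.comp_neg).mono' (by fun_prop) (ae_of_all _ fun z => ?_)
      simp only [Pi.add_apply, norm_one]
      nlinarith [Real.add_one_le_exp (t * x * z), Real.add_one_le_exp (t * x * -z)]
    rw [integrable_const_iff] at h2
    simp [isFiniteMeasure_iff] at h2
  simp [hx]

lemma integrable_sq_of_mom_le {ν : Measure ℝ} {c : ℝ≥0∞} (hc : c < ⊤) (h : mom 2 ν ≤ c) :
    Integrable (fun x => x ^ 2) ν := by
  refine ⟨by fun_prop, ?_⟩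
  rw [hasFiniteIntegral_iff_ofReal (ae_of_all _ fun _ => sq_nonneg _)]
  simpa [mom] using h.trans_lt hc

lemma mom_two_eq {ν : Measure ℝ} (h : Integrable (fun x => x ^ 2) ν) :
    mom 2 ν = ENNReal.ofReal (∫ x, x ^ 2 ∂ν) := by
  rw [ofReal_integral_eq_lintegral_ofReal h (ae_of_all _ fun _ => sq_nonneg _)]
  simp [mom]

lemma Psig_eq_coe {q : ℝ} {γ ν : Measure ℝ} [IsProbabilityMeasure γ] [IsFiniteMeasure ν]
    (hq : 2 < q) (hγ : memT q γ) (hν : Integrable (fun x => x ^ 2) ν) (t : ℝ) :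
    Psig γ ν t = ((∫ z, cgf id γ (t * z) ∂ν : ℝ) : EReal) :=
  eIntegral_eq_integral (ae_of_all _ fun _ => hγ.logM_eq _)
    ((hγ.isSubquadratic hq).integrable_comp_mul hν t)

/-- The function whose supremum over `s > 0` and `t` is the Legendre transform of `Phig γ` at
`(1, w)`, where `L` is the log moment generating function of `γ`. -/
def dualObjective (L : ℝ → ℝ) (w s t : ℝ) : ℝ :=
  1 / 2 - s + t * w - Real.log ((√(2 * Real.pi))⁻¹ * partitionFn L s t)

namespace IsSubquadratic

variable {L : ℝ → ℝ}

lemma dualObjective_half_zero (hL : IsSubquadratic L) (w : ℝ) :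
    dualObjective L w (1 / 2) 0 = 0 := by
  have h : √(2 * Real.pi) ≠ 0 := (Real.sqrt_pos.2 (by positivity)).ne'
  rw [dualObjective, hL.partitionFn_zero, show Real.pi / (1 / 2) = 2 * Real.pi by ring,
    inv_mul_cancel₀ h]
  simp

lemma continuousOn_dualObjective (hL : IsSubquadratic L) (w : ℝ) :
    ContinuousOn (fun x : ℝ × ℝ => dualObjective L w x.1 x.2) {x | 0 < x.1} := by
  unfold dualObjective
  refine ContinuousOn.sub (by fun_prop)
    (ContinuousOn.log (continuousOn_const.mul hL.continuousOn_partitionFn) fun x hx => ?_)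
  have := hL.partitionFn_pos (hx : 0 < x.1) x.2
  positivity

lemma dualObjective_le (hL : IsSubquadratic L) {w s t a b : ℝ} (hs : 0 < s) (ha : 0 ≤ a)
    (h : (∀ y, 0 ≤ y → a * y - b ≤ L y) ∨ ∀ y, 0 ≤ y → a * y - b ≤ L (-y)) :
    dualObjective L w s t ≤ 3 / 2 + b + Real.log (2 * Real.pi) / 2 - s + t * w + Real.log s / 2
      - a ^ 2 * t ^ 2 / (4 * s) := by
  have h1 := Real.log_le_log (by positivity) (hL.le_partitionFn (t := t) hs ha h)
  rw [Real.log_mul (by positivity) (Real.exp_pos _).ne', Real.log_exp, Real.log_inv,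
    Real.log_sqrt hs.le] at h1
  rw [dualObjective, Real.log_mul (by positivity) (hL.partitionFn_pos hs t).ne', Real.log_inv,
    Real.log_sqrt (by positivity)]
  linarith

lemma exists_isMax_dualObjective (hL : IsSubquadratic L) {w a b : ℝ} (ha : |w| < a)
    (h : (∀ y, 0 ≤ y → a * y - b ≤ L y) ∨ ∀ y, 0 ≤ y → a * y - b ≤ L (-y)) :
    ∃ s₀ t₀, 0 < s₀ ∧ ∀ s t, 0 < s → dualObjective L w s t ≤ dualObjective L w s₀ t₀ := by
  have ha0 : 0 < a := (abs_nonneg w).trans_lt ha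
  have hw : w ^ 2 < a ^ 2 := sq_lt_sq.2 (by rwa [abs_of_pos ha0])
  obtain ⟨l, hl1, hl2⟩ := exists_between ((div_lt_one (by positivity)).2 hw)
  have hl0 : 0 < l := lt_of_le_of_lt (by positivity) hl1
  set α := (1 - l) / 2 with hα
  have hα0 : 0 < α := by linarith
  set β := a ^ 2 / 4 - w ^ 2 / (4 * l) with hβ
  have hβ0 : 0 < β := by
    have h1 : w ^ 2 / l < a ^ 2 := by
      rw [div_lt_iff₀ (by positivity)] at hl1 ⊢
      linarith
    have h2 : w ^ 2 / (4 * l) = w ^ 2 / l / 4 := by field_simp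
    rw [hβ, h2]
    linarith
  set B := 3 / 2 + b + Real.log (2 * Real.pi) / 2 with hB
  have hle (s t : ℝ) (hs : 0 < s) :
      dualObjective L w s t ≤ B + Real.log s / 2 - 2 * α * s - β * t ^ 2 / s := by
    refine (hL.dualObjective_le hs ha0.le h).trans ?_
    have h1 : t * w ≤ l * s + w ^ 2 * t ^ 2 / (4 * l * s) := by
      rw [← sub_nonneg]
      have : l * s + w ^ 2 * t ^ 2 / (4 * l * s) - t * w
          = (2 * l * s - w * t) ^ 2 / (4 * l * s) := by
        field_simp
        ring
      rw [this]
      positivity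
    have h2 : β * t ^ 2 / s = a ^ 2 * t ^ 2 / (4 * s) - w ^ 2 * t ^ 2 / (4 * l * s) := by
      rw [hβ]
      field_simp
    rw [h2, hα]
    linarith
  set B' := B - 1 / 2 - Real.log (2 * α) / 2 with hB'
  have hle' (s t : ℝ) (hs : 0 < s) :
      dualObjective L w s t ≤ B' - α * s - β * t ^ 2 / s := by
    have h1 := Real.log_le_sub_one_of_pos (show 0 < 2 * α * s by positivity)
    rw [Real.log_mul (by positivity) hs.ne'] at h1
    linarith [hle s t hs]
  set K : Set (ℝ × ℝ) := Icc (Real.exp (-(2 * B))) (B' / α)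
    ×ˢ Icc (-√(B' * (B' / α) / β)) (√(B' * (B' / α) / β)) with hK
  have hmem (s t : ℝ) (hs : 0 < s) (h0 : 0 ≤ dualObjective L w s t) : (s, t) ∈ K := by
    have h1 := h0.trans (hle s t hs)
    have h2 := h0.trans (hle' s t hs)
    have h3 : 0 ≤ β * t ^ 2 / s := by positivity
    have h4 : 0 < α * s := by positivity
    have h5 : s ≤ B' / α := by
      rw [le_div_iff₀ hα0]
      linarith
    have h6 : Real.exp (-(2 * B)) ≤ s := by
      rw [← Real.le_log_iff_exp_le hs]
      linarith
    have h7 : t ^ 2 ≤ B' * (B' / α) / β := by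
      rw [le_div_iff₀ hβ0]
      have h8 : β * t ^ 2 / s ≤ B' := by linarith
      rw [div_le_iff₀ hs] at h8
      nlinarith
    exact ⟨⟨h6, h5⟩, abs_le.1 (Real.abs_le_sqrt h7)⟩
  have hKc : IsCompact K := isCompact_Icc.prod isCompact_Icc
  have hKpos : K ⊆ {x | 0 < x.1} := fun x hx => (Real.exp_pos _).trans_le hx.1.1
  have hz := hL.dualObjective_half_zero w
  obtain ⟨⟨s₀, t₀⟩, h₀, hmax⟩ := hKc.exists_isMaxOn ⟨_, hmem (1 / 2) 0 (by norm_num) hz.ge⟩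
    ((hL.continuousOn_dualObjective w).mono hKpos)
  refine ⟨s₀, t₀, hKpos h₀, fun s t hs => ?_⟩
  rcases le_total 0 (dualObjective L w s t) with h0 | h0
  · exact hmax (hmem s t hs h0)
  · exact h0.trans (hz.ge.trans (hmax (hmem (1 / 2) 0 (by norm_num) hz.ge)))

lemma exists_le_dualObjective (hL : IsSubquadratic L) {w : ℝ} (hw : w ≠ 0)
    (h : ∀ y, L y ≤ |w| * |y|) (B : ℝ) : ∃ s t, 0 < s ∧ B ≤ dualObjective L w s t := by
  set s := Real.exp (2 * (B + Real.log 2)) / 2 with hs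
  have hs0 : 0 < s := by positivity
  refine ⟨s, 2 * s / w, hs0, ?_⟩
  have h1 := Real.log_le_log (hL.partitionFn_pos hs0 _) (hL.partitionFn_le hs0 hw h)
  rw [Real.log_mul (by positivity) (by positivity), Real.log_mul (by positivity) (by positivity),
    Real.log_exp, Real.log_sqrt (by positivity), Real.log_div (by positivity) hs0.ne'] at h1
  have h2 : Real.log s = 2 * (B + Real.log 2) - Real.log 2 := by
    rw [hs, Real.log_div (by positivity) (by positivity), Real.log_exp]
  rw [dualObjective, Real.log_mul (by positivity) (hL.partitionFn_pos hs0 _).ne', Real.log_inv,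
    Real.log_sqrt (by positivity), Real.log_mul (by positivity) (by positivity),
    div_mul_cancel₀ _ hw]
  linarith

end IsSubquadratic

lemma cgf_id_le_of_ae {γ : Measure ℝ} [IsProbabilityMeasure γ]
    (h : ∀ t, Integrable (fun y => Real.exp (t * y)) γ) {w : ℝ} (hw : ∀ᵐ x ∂γ, |x| ≤ w) (y : ℝ) :
    cgf id γ y ≤ w * |y| := by
  rw [← Real.exp_le_exp, exp_cgf (X := id) (h y), mgf]
  refine (integral_mono_ae (h y) (integrable_const (Real.exp (w * |y|))) ?_).trans_eq (by simp)
  filter_upwards [hw] with x hx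
  rw [Real.exp_le_exp]
  calc y * x ≤ |y * x| := le_abs_self _
    _ = |x| * |y| := by rw [abs_mul, mul_comm]
    _ ≤ w * |y| := by gcongr

lemma exists_le_cgf_id {γ : Measure ℝ} [IsProbabilityMeasure γ]
    (h : ∀ t, Integrable (fun y => Real.exp (t * y)) γ) {w : ℝ} (hw : ¬ ∀ᵐ x ∂γ, |x| ≤ w) :
    ∃ a b, w < a ∧ ((∀ y, 0 ≤ y → a * y - b ≤ cgf id γ y) ∨
      ∀ y, 0 ≤ y → a * y - b ≤ cgf id γ (-y)) := by
  have hex : ∃ a, w < a ∧ γ {x | a ≤ |x|} ≠ 0 := by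
    by_contra! hcon
    refine hw ?_
    have hn (n : ℕ) : ∀ᵐ x ∂γ, |x| < w + 1 / (n + 1 : ℝ) := by
      rw [ae_iff]
      simpa using hcon (w + 1 / (n + 1 : ℝ)) (by simp; positivity)
    filter_upwards [ae_all_iff.2 hn] with x hx
    refine ge_of_tendsto' (f := fun n : ℕ => w + 1 / (n + 1 : ℝ)) (x := atTop) ?_
      fun n => (hx n).le
    simpa using tendsto_one_div_add_atTop_nhds_zero_nat.const_add w
  obtain ⟨a, ha, h0⟩ := hex
  have hsplit : γ {x | a ≤ x} ≠ 0 ∨ γ {x | x ≤ -a} ≠ 0 := by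
    by_contra! hcon
    refine h0 (measure_mono_null (fun x (hx : a ≤ |x|) => ?_) (measure_union_null hcon.1 hcon.2))
    rcases le_abs.1 hx with h | h
    · exact Or.inl h
    · exact Or.inr (show x ≤ -a by linarith)
  rcases hsplit with h1 | h1
  · refine ⟨a, -Real.log (γ.real {x | a ≤ x}), ha, Or.inl fun y hy => ?_⟩
    have h2 := measure_ge_le_exp_cgf (X := id) a hy (h y)
    have h3 := Real.log_le_log (ENNReal.toReal_pos h1 (measure_ne_top _ _)) h2
    rw [Real.log_exp] at h3
    rw [measureReal_def]
    linarith
  · refine ⟨a, -Real.log (γ.real {x | x ≤ -a}), ha, Or.inr fun y hy => ?_⟩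
    have h2 := measure_le_le_exp_cgf (X := id) (-a) (neg_nonpos.2 hy) (h (-y))
    have h3 := Real.log_le_log (ENNReal.toReal_pos h1 (measure_ne_top _ _)) h2
    rw [Real.log_exp] at h3
    rw [measureReal_def]
    linarith

/-- The standard Gaussian measure tilted by `z ↦ (1/2 - s) z² + L (t z)`. -/
def tiltedGaussian (L : ℝ → ℝ) (s t : ℝ) : Measure ℝ :=
  (gaussianReal 0 1).tilted fun z => (1 / 2 - s) * z ^ 2 + L (t * z)

lemma integrable_exp_gaussianReal_of_le {f : ℝ → ℝ} (hf : Continuous f) {s K : ℝ} (hs : 0 < s)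
    (h : ∀ z, f z ≤ (1 / 2 - s) * z ^ 2 + K) :
    Integrable (fun z => Real.exp (f z)) (gaussianReal 0 1) := by
  rw [integrable_gaussianReal_iff]
  refine ((integrable_exp_neg_mul_sq hs).const_mul (Real.exp K)).mono' (by fun_prop)
    (ae_of_all _ fun z => ?_)
  rw [← Real.exp_add, ← Real.exp_add, Real.norm_of_nonneg (Real.exp_nonneg _), Real.exp_le_exp]
  linarith [h z]

namespace IsSubquadratic

variable {L : ℝ → ℝ}

lemma isProbabilityMeasure_tiltedGaussian (hL : IsSubquadratic L) {s : ℝ} (hs : 0 < s) (t : ℝ) :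
    IsProbabilityMeasure (tiltedGaussian L s t) :=
  isProbabilityMeasure_tilted (hL.integrable_exp_gaussianReal hs t)

lemma zero_mem_interior_integrableExpSet (hL : IsSubquadratic L) {s : ℝ} (hs : 0 < s)
    (t a t' : ℝ) :
    0 ∈ interior (integrableExpSet (fun z => a * z ^ 2 + L (t' * z) - L (t * z))
      (tiltedGaussian L s t)) := by
  obtain ⟨K₁, -, h₁⟩ := hL.exists_le t' one_pos
  obtain ⟨K₂, -, h₂⟩ := hL.exists_le t one_pos
  obtain ⟨K₃, -, h₃⟩ := hL.exists_le t (show 0 < s / 4 by positivity)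
  have hc := hL.continuous
  rw [mem_interior_iff_mem_nhds, Metric.mem_nhds_iff]
  refine ⟨s / (4 * (|a| + 2)), by positivity, fun ε hε => ?_⟩
  rw [Metric.mem_ball, dist_zero_right, Real.norm_eq_abs, lt_div_iff₀ (by positivity)] at hε
  rw [integrableExpSet, mem_ofPred, tiltedGaussian,
    integrable_tilted_iff (hL.integrable_exp_gaussianReal hs t)]
  simp_rw [smul_eq_mul, ← Real.exp_add]
  refine integrable_exp_gaussianReal_of_le (s := s / 2) (K := K₃ + |ε| * (K₁ + K₂)) (by fun_prop)
    (by positivity) fun z => ?_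
  have hD : |a * z ^ 2 + L (t' * z) - L (t * z)| ≤ (|a| + 2) * z ^ 2 + (K₁ + K₂) := by
    have h0 : |a * z ^ 2| = |a| * z ^ 2 := by rw [abs_mul, abs_of_nonneg (sq_nonneg z)]
    have h4 := abs_sub (a * z ^ 2 + L (t' * z)) (L (t * z))
    have h5 := abs_add_le (a * z ^ 2) (L (t' * z))
    linarith [h₁ t' z le_rfl, h₂ t z le_rfl]
  have h6 : ε * (a * z ^ 2 + L (t' * z) - L (t * z))
      ≤ |ε| * ((|a| + 2) * z ^ 2 + (K₁ + K₂)) := by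
    refine (le_abs_self _).trans ?_
    rw [abs_mul]
    gcongr
  have h7 : |ε| * (|a| + 2) * z ^ 2 ≤ s / 4 * z ^ 2 := by
    gcongr
    linarith
  linarith [le_abs_self (L (t * z)), h₃ t z le_rfl]

lemma integral_variation_ge (hL : IsSubquadratic L) {w s t : ℝ} (hs : 0 < s)
    (hmax : ∀ s' t', 0 < s' → dualObjective L w s' t' ≤ dualObjective L w s t) (a t' : ℝ) :
    a + (t' - t) * w
      ≤ ∫ z, (a * z ^ 2 + L (t' * z) - L (t * z)) ∂tiltedGaussian L s t := by
  have := hL.isProbabilityMeasure_tiltedGaussian hs t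
  set D : ℝ → ℝ := fun z => a * z ^ 2 + L (t' * z) - L (t * z) with hD
  have hint := hL.zero_mem_interior_integrableExpSet hs t a t'
  have hder := (hasDerivAt_mgf hint).tendsto_slope_zero_right
  simp only [zero_mul, Real.exp_zero, mul_one, zero_add, mgf_zero, smul_eq_mul] at hder
  refine ge_of_tendsto hder ?_
  have hnhds : ∀ᶠ ε in 𝓝[>] (0 : ℝ), ε ∈ integrableExpSet D (tiltedGaussian L s t) :=
    nhdsWithin_le_nhds (mem_interior_iff_mem_nhds.1 hint)
  have hpos : ∀ᶠ ε in 𝓝[>] (0 : ℝ), 0 < s - ε * a := by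
    have hc : Continuous fun ε : ℝ => s - ε * a := by fun_prop
    exact nhdsWithin_le_nhds (hc.continuousAt.eventually (lt_mem_nhds (by simpa using hs)))
  have hone : ∀ᶠ ε in 𝓝[>] (0 : ℝ), ε < 1 := nhdsWithin_le_nhds (gt_mem_nhds one_pos)
  filter_upwards [hnhds, hpos, hone, self_mem_nhdsWithin] with ε hε hsε hε1 hε0
  have hε0 : 0 < ε := hε0
  rw [inv_mul_eq_div, le_div_iff₀ hε0]
  have hg := hL.integrable_exp_gaussianReal hs t
  rw [integrableExpSet, mem_ofPred, tiltedGaussian, integrable_tilted_iff hg] at hε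
  simp_rw [smul_eq_mul, ← Real.exp_add] at hε
  have hZ : 0 < ∫ z, Real.exp ((1 / 2 - s) * z ^ 2 + L (t * z)) ∂gaussianReal 0 1 :=
    integral_exp_pos hg
  have hgε := hL.integrable_exp_gaussianReal hsε (t + ε * (t' - t))
  have hmgf : mgf D (tiltedGaussian L s t) ε
      = (∫ z, Real.exp ((1 / 2 - s) * z ^ 2 + L (t * z) + ε * D z) ∂gaussianReal 0 1)
        / ∫ z, Real.exp ((1 / 2 - s) * z ^ 2 + L (t * z)) ∂gaussianReal 0 1 :=
    integral_exp_tilted _ _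
  have hle : ∫ z, Real.exp ((1 / 2 - (s - ε * a)) * z ^ 2 + L ((t + ε * (t' - t)) * z))
        ∂gaussianReal 0 1
      ≤ ∫ z, Real.exp ((1 / 2 - s) * z ^ 2 + L (t * z) + ε * D z) ∂gaussianReal 0 1 := by
    refine integral_mono hgε hε fun z => Real.exp_le_exp.2 ?_
    have hcv := hL.convexOn.2 (mem_univ (t * z)) (mem_univ (t' * z)) (sub_nonneg.2 hε1.le)
      hε0.le (by ring)
    simp only [smul_eq_mul] at hcv
    rw [show (1 - ε) * (t * z) + ε * (t' * z) = (t + ε * (t' - t)) * z by ring] at hcv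
    rw [hD]
    linarith
  have hm := hmax (s - ε * a) (t + ε * (t' - t)) hsε
  rw [dualObjective, dualObjective, ← integral_exp_gaussianReal, ← integral_exp_gaussianReal] at hm
  have h1 := Real.log_le_log (integral_exp_pos hgε) hle
  have h2 := Real.log_le_sub_one_of_pos (div_pos ((integral_exp_pos hgε).trans_le hle) hZ)
  rw [Real.log_div ((integral_exp_pos hgε).trans_le hle).ne' hZ.ne', ← hmgf] at h2
  linarith

lemma integrable_sq_tiltedGaussian (hL : IsSubquadratic L) {s : ℝ} (hs : 0 < s) (t : ℝ) :
    Integrable (fun z => z ^ 2) (tiltedGaussian L s t) := by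
  simpa using integrable_of_mem_interior_integrableExpSet
    (hL.zero_mem_interior_integrableExpSet hs t 1 t)

lemma integral_sq_tiltedGaussian_eq_one (hL : IsSubquadratic L) {w s t : ℝ} (hs : 0 < s)
    (hmax : ∀ s' t', 0 < s' → dualObjective L w s' t' ≤ dualObjective L w s t) :
    ∫ z, z ^ 2 ∂tiltedGaussian L s t = 1 := by
  have h1 := hL.integral_variation_ge hs hmax 1 t
  have h2 := hL.integral_variation_ge hs hmax (-1) t
  simp only [sub_self, zero_mul, add_zero, add_sub_cancel_right, one_mul, neg_mul,
    integral_neg] at h1 h2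
  linarith

lemma relEnt_tiltedGaussian (hL : IsSubquadratic L) {w s t : ℝ} (hs : 0 < s)
    (hm : ∫ z, z ^ 2 ∂tiltedGaussian L s t = 1) :
    relEnt (tiltedGaussian L s t) (gaussianReal 0 1)
      = ((dualObjective L w s t - (t * w - ∫ z, L (t * z) ∂tiltedGaussian L s t) : ℝ) : EReal) := by
  have := hL.isProbabilityMeasure_tiltedGaussian hs t
  have hg := hL.integrable_exp_gaussianReal hs t
  have hsq := hL.integrable_sq_tiltedGaussian hs t
  have hLi := hL.integrable_comp_mul hsq t
  have hac : tiltedGaussian L s t ≪ gaussianReal 0 1 := tilted_absolutelyContinuous _ _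
  have hi : Integrable (fun z => (1 / 2 - s) * z ^ 2 + L (t * z)) (tiltedGaussian L s t) :=
    (hsq.const_mul _).add hLi
  have hllr : llr (tiltedGaussian L s t) (gaussianReal 0 1) =ᵐ[tiltedGaussian L s t] fun z =>
      (1 / 2 - s) * z ^ 2 + L (t * z) - Real.log ((√(2 * Real.pi))⁻¹ * partitionFn L s t) := by
    rw [← integral_exp_gaussianReal]
    exact hac.ae_le (log_rnDeriv_tilted_left_self hg)
  rw [relEnt_eq_integral_llr hac ((hi.sub (integrable_const _)).congr hllr.symm),
    integral_congr_ae hllr, integral_sub hi (integrable_const _),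
    integral_add (hsq.const_mul _) hLi, integral_const_mul, hm, integral_const, dualObjective]
  simp only [probReal_univ, one_smul]
  congr 1
  ring

end IsSubquadratic

instance isProbabilityMeasure_muP_two : IsProbabilityMeasure (muP 2) := by
  rw [muP_two]
  infer_instance

lemma mom_two_muP_two : mom 2 (muP 2) = 1 := by
  have hi : Integrable (fun x => x ^ 2) (gaussianReal 0 1) :=
    (memLp_id_gaussianReal 2).integrable_sq
  rw [muP_two, mom_two_eq hi]
  have h := variance_of_integral_eq_zero (μ := gaussianReal 0 1) (X := id) aemeasurable_id
    (by simp)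
  rw [variance_id_gaussianReal] at h
  simp only [id] at h
  rw [← h]
  simp

lemma relEnt_self_muP_two : relEnt (muP 2) (muP 2) = 0 := by
  rw [muP_two]
  have h := llr_self (gaussianReal 0 1)
  rw [relEnt_eq_integral_llr Measure.AbsolutelyContinuous.rfl
    ((integrable_zero _ _ _).congr h.symm), integral_congr_ae h]
  simp

section

variable {q : ℝ} {γ : Measure ℝ} [IsProbabilityMeasure γ]

lemma Iqg_ne_bot (hq : 2 < q) (hγ : memT q γ) {ν : Measure ℝ} [IsFiniteMeasure ν]
    (hν : Integrable (fun x => x ^ 2) ν) (w : ℝ) : Iqg γ ν w ≠ ⊥ := by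
  refine ne_bot_of_le_ne_bot (EReal.coe_ne_bot 0) (le_iSup_of_le (0 : ℝ) ?_)
  rw [Psig_eq_coe hq hγ hν]
  simp

lemma Iag_le (hq : 2 < q) (hγ : memT q γ) {ν : Measure ℝ} [IsProbabilityMeasure ν]
    (hν : mom 2 ν ≤ 1) (w : ℝ) :
    Iag γ w ≤ Iqg γ ν w + relEnt ν (muP 2) + (((1 - (mom 2 ν).toReal) / 2 : ℝ) : EReal) := by
  have hsq := integrable_sq_of_mom_le ENNReal.one_lt_top hν
  have hL := hγ.isSubquadratic hq
  rw [muP_two]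
  by_cases hent : ν ≪ gaussianReal 0 1 ∧ Integrable (llr ν (gaussianReal 0 1)) ν
  swap
  · rw [relEnt_eq_top hent, EReal.add_top_of_ne_bot (Iqg_ne_bot hq hγ hsq w),
      EReal.top_add_of_ne_bot (EReal.coe_ne_bot _)]
    exact le_top
  obtain ⟨hac, hllr⟩ := hent
  have hm1 : ∫ x, x ^ 2 ∂ν ≤ 1 := by
    rwa [mom_two_eq hsq, ← ENNReal.ofReal_one, ENNReal.ofReal_le_ofReal_iff zero_le_one] at hν
  rw [relEnt_eq_integral_llr hac hllr, mom_two_eq hsq,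
    ENNReal.toReal_ofReal (integral_nonneg fun _ => sq_nonneg _), add_assoc, ← EReal.coe_add]
  refine iInf₂_le_of_le (1, w) ⟨one_pos, by simp⟩ (iSup_le fun ⟨a, t⟩ => ?_)
  rcases le_or_gt (1 / 2) a with ha | ha
  · rw [Phig_eq_top ha, EReal.sub_top]
    exact bot_le
  obtain ⟨s, rfl⟩ : ∃ s, a = 1 / 2 - s := ⟨1 / 2 - a, by ring⟩
  have hs : 0 < s := by linarith
  have hLi := hL.integrable_comp_mul hsq t
  have hdv := integral_sub_integral_llr_le hac hllr ((hsq.const_mul (1 / 2 - s)).add hLi)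
    (hL.integrable_exp_gaussianReal hs t)
  simp only [Pi.add_apply] at hdv
  rw [integral_add (hsq.const_mul _) hLi, integral_const_mul] at hdv
  have hle : ((t * w - ∫ z, cgf id γ (t * z) ∂ν : ℝ) : EReal) ≤ Iqg γ ν w := by
    refine le_iSup_of_le t ?_
    rw [Psig_eq_coe hq hγ hsq, ← EReal.coe_sub]
  refine le_trans ?_ (add_le_add_left hle _)
  rw [Phig_eq_coe hq hγ hs, ← EReal.coe_sub, ← EReal.coe_add, EReal.coe_le_coe_iff]
  nlinarith

lemma dualObjective_le_legendre2 (hq : 2 < q) (hγ : memT q γ) {w s : ℝ} (hs : 0 < s) (t : ℝ)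
    {τ : ℝ × ℝ} (hτ : 0 < τ.1) (hw : τ.1 ^ (-(1 : ℝ) / 2) * τ.2 = w) :
    (dualObjective (cgf id γ) w s t : EReal) ≤ legendre2 (Phig γ) τ := by
  have hL := hγ.isSubquadratic hq
  set c := τ.1 ^ (-(1 : ℝ) / 2) with hc
  have hc0 : 0 < c := Real.rpow_pos_of_pos hτ _
  have hcτ : c ^ 2 * τ.1 = 1 := by
    rw [hc, ← Real.rpow_natCast, ← Real.rpow_mul hτ.le, ← Real.rpow_add_one hτ.ne']
    norm_num
  have hlog : Real.log c = -(1 / 2) * Real.log τ.1 := by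
    rw [hc, Real.log_rpow hτ]
    ring
  have hpos := hL.partitionFn_pos hs t
  refine le_iSup_of_le (1 / 2 - s * c ^ 2, t * c) ?_
  rw [Phig_eq_coe hq hγ (by positivity), ← EReal.coe_sub, EReal.coe_le_coe_iff,
    IsSubquadratic.integral_exp_gaussianReal, partitionFn_scale _ _ _ hc0, mul_left_comm,
    Real.log_mul (inv_pos.2 hc0).ne' (by positivity), Real.log_inv, hlog, dualObjective]
  have h1 : (1 / 2 - s * c ^ 2) * τ.1 + t * c * τ.2 = τ.1 / 2 - s + t * w := by
    rw [← hw]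
    linear_combination -s * hcτ
  linarith [Real.log_le_sub_one_of_pos hτ]

lemma iInf_le_legendre2 (hq : 2 < q) (hγ : memT q γ) {w : ℝ}
    {τ : ℝ × ℝ} (hτ : 0 < τ.1) (hw : τ.1 ^ (-(1 : ℝ) / 2) * τ.2 = w) :
    ⨅ ν ∈ {ν : Measure ℝ | IsProbabilityMeasure ν ∧ mom 2 ν ≤ 1},
        Iqg γ ν w + relEnt ν (muP 2) + (((1 - (mom 2 ν).toReal) / 2 : ℝ) : EReal)
      ≤ legendre2 (Phig γ) τ := by
  have hL := hγ.isSubquadratic hq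
  by_cases hcase : ∀ᵐ x ∂γ, |x| ≤ |w|
  · have hle := cgf_id_le_of_ae hγ.integrable_exp hcase
    rcases eq_or_ne w 0 with h0 | h0
    · refine iInf₂_le_of_le (muP 2) ⟨inferInstance, mom_two_muP_two.le⟩ ?_
      have hsq := integrable_sq_of_mom_le ENNReal.one_lt_top mom_two_muP_two.le
      have hz : cgf id γ = 0 := by
        have hx : id =ᵐ[γ] fun _ => (0 : ℝ) := by
          filter_upwards [hcase] with x hx
          simpa [h0] using hx
        funext y
        simp [cgf, mgf_congr hx]
      have hI : Iqg γ (muP 2) w = 0 := by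
        simp [Iqg, legendre1, Psig_eq_coe hq hγ hsq, hz, h0]
      rw [hI, relEnt_self_muP_two, mom_two_muP_two]
      refine le_trans ?_ (dualObjective_le_legendre2 hq hγ (one_half_pos (α := ℝ)) 0 hτ hw)
      rw [hL.dualObjective_half_zero]
      simp
    · have htop : legendre2 (Phig γ) τ = ⊤ := by
        refine EReal.eq_top_iff_forall_lt _ |>.2 fun B => ?_
        obtain ⟨s, t, hs, hB⟩ := hL.exists_le_dualObjective h0 hle (B + 1)
        refine lt_of_lt_of_le ?_ (dualObjective_le_legendre2 hq hγ hs t hτ hw)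
        exact EReal.coe_lt_coe_iff.2 (by linarith)
      rw [htop]
      exact le_top
  · obtain ⟨a, b, ha, hab⟩ := exists_le_cgf_id hγ.integrable_exp hcase
    obtain ⟨s, t, hs, hmax⟩ := hL.exists_isMax_dualObjective ha hab
    have hprob := hL.isProbabilityMeasure_tiltedGaussian hs t
    have hsq := hL.integrable_sq_tiltedGaussian hs t
    have hm := hL.integral_sq_tiltedGaussian_eq_one hs hmax
    have hmom : mom 2 (tiltedGaussian (cgf id γ) s t) = 1 := by
      rw [mom_two_eq hsq, hm, ENNReal.ofReal_one]
    refine iInf₂_le_of_le _ ⟨hprob, hmom.le⟩ ?_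
    have hI : Iqg γ (tiltedGaussian (cgf id γ) s t) w
        ≤ ((t * w - ∫ z, cgf id γ (t * z) ∂tiltedGaussian (cgf id γ) s t : ℝ) : EReal) := by
      refine iSup_le fun t' => ?_
      rw [Psig_eq_coe hq hγ hsq, ← EReal.coe_sub, EReal.coe_le_coe_iff]
      have h := hL.integral_variation_ge hs hmax 0 t'
      simp only [zero_mul, zero_add] at h
      rw [integral_sub (hL.integrable_comp_mul hsq t') (hL.integrable_comp_mul hsq t)] at h
      linarith
    refine le_trans ?_ (dualObjective_le_legendre2 hq hγ hs t hτ hw)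
    rw [muP_two, hL.relEnt_tiltedGaussian (w := w) hs hm, hmom, add_assoc, ← EReal.coe_add]
    refine (add_le_add_left hI _).trans ?_
    rw [← EReal.coe_add, EReal.coe_le_coe_iff, ENNReal.toReal_one]
    linarith

end

end LDP

/-- Variational formula for product measures `γ ∈ 𝒯_q`, `q > 2`. -/
theorem statement12
    (γ : Measure ℝ) [IsProbabilityMeasure γ] (q : ℝ) (hq : 2 < q) (hγ : memT q γ) :
    (∀ w : ℝ, Iag γ w =
      ⨅ ν ∈ {ν : Measure ℝ | IsProbabilityMeasure ν ∧ mom 2 ν ≤ 1},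
        Iqg γ ν w + relEnt ν (muP 2) + (((1 - (mom 2 ν).toReal) / 2 : ℝ) : EReal))
    ∧ (∀ w : ℝ, Iag γ w ≤ Iqg γ (muP 2) w) := by
  refine ⟨fun w => le_antisymm ?_ ?_, fun w => ?_⟩
  · exact le_iInf₂ fun ν ⟨_, hν⟩ => Iag_le hq hγ hν w
  · exact le_iInf₂ fun τ ⟨hτ, hw⟩ => iInf_le_legendre2 hq hγ hτ hw
  · simpa [relEnt_self_muP_two, mom_two_muP_two] using Iag_le hq hγ mom_two_muP_two.le w
end
end

section
/- Let (ξ_n)_{n∈ℕ} be a sequence of real-valued random variables satisfying a large deviation principle with speed n and a good rate function I that is quasiconvex and symmetric. Let U be uniformly distributed on [0,1] with U independent of ξ_n for each n. Then the sequence (U^{1/n} ξ_n)_{n∈ℕ} satisfies a large deviation principle with speed n and the same good rate function I. -/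
open MeasureTheory Filter Topology Set ProbabilityTheory
open scoped ENNReal NNReal

noncomputable section

open LDP

/-- A symmetric quasiconvex function is monotone in the absolute value. -/
theorem LDP.QuasiconvexRate.le_of_abs_le {I : ℝ → EReal} (hquasi : QuasiconvexRate I)
    (hsymm : SymmetricRate I) {x y : ℝ} (h : |x| ≤ |y|) : I x ≤ I y := by
  have hy : I |y| = I y := by
    rcases abs_choice y with hy | hy <;> rw [hy]
    exact hsymm y
  have hmem : x ∈ segment ℝ (-|y|) |y| := by
    rw [segment_eq_Icc (neg_le_self (abs_nonneg y))]
    exact abs_le.mp h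
  exact (hquasi (I y)).segment_subset (show I (-|y|) ≤ I y by rw [hsymm, hy]) hy.le hmem

/-- Multiplication by a factor with values in `[0,1]` does not worsen the large deviation upper
bound when the rate function is quasiconvex and symmetric. -/
theorem LDP.IsLDP.limsup_mul_le {Ω : Type*} [MeasurableSpace Ω] {P : Measure Ω}
    {ξ : ℕ → Ω → ℝ} {I : ℝ → EReal} (hLDP : IsLDP P ξ (fun n => (n : ℝ)) I)
    (hquasi : QuasiconvexRate I) (hsymm : SymmetricRate I) {V : ℕ → Ω → ℝ}
    (hV : ∀ n, ∀ᵐ ω ∂P, V n ω ∈ Icc (0 : ℝ) 1) {F : Set ℝ} (hF : IsClosed F) :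
    (atTop.limsup fun n : ℕ =>
        (((n : ℝ)⁻¹ : ℝ) : EReal) * ENNReal.log (P {ω | V n ω * ξ n ω ∈ F})) ≤
      -(⨅ x ∈ F, I x) := by
  rcases F.eq_empty_or_nonempty with rfl | hne
  · have hbot : ∀ᶠ n : ℕ in atTop,
        (((n : ℝ)⁻¹ : ℝ) : EReal) * ENNReal.log (P {ω | V n ω * ξ n ω ∈ (∅ : Set ℝ)}) = ⊥ := by
      filter_upwards [eventually_gt_atTop 0] with n hn
      have hn' : (0 : ℝ) < (n : ℝ)⁻¹ := by positivity
      simpa using EReal.coe_mul_bot_of_pos hn'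
    rw [limsup_congr hbot]
    simp
  obtain ⟨x₀, hx₀, hdist⟩ := hF.exists_infDist_eq_dist hne 0
  have hmin : ∀ x ∈ F, |x₀| ≤ |x| := fun x hx => by
    simpa [hdist] using Metric.infDist_le_dist_of_mem (x := (0 : ℝ)) hx
  have hclosed : IsClosed {x : ℝ | |x₀| ≤ |x|} := isClosed_le continuous_const continuous_abs
  have hupper := (hLDP.2 _ hclosed.measurableSet).2
  rw [hclosed.closure_eq] at hupper
  calc _ ≤ _ := limsup_le_limsup (Eventually.of_forall fun n => ?_)
    _ ≤ _ := hupper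
    _ ≤ _ := EReal.neg_le_neg_iff.mpr <| (iInf₂_le x₀ hx₀).trans <|
      le_iInf₂ fun x hx => hquasi.le_of_abs_le hsymm hx
  refine mul_le_mul_of_nonneg_left (ENNReal.log_monotone (measure_mono_ae ?_))
    (EReal.coe_nonneg.mpr (by positivity))
  filter_upwards [hV n] with ω hω hmem
  refine (hmin _ hmem).trans ?_
  rw [abs_mul, abs_of_nonneg hω.1]
  exact mul_le_of_le_one_left (abs_nonneg _) hω.2

/-- A constant factor `c ≠ 0, ∞` is negligible on the exponential scale. -/
theorem LDP.liminf_log_le_liminf_log_const_mul (p : ℕ → ℝ≥0∞) {c : ℝ≥0∞} (hc₀ : c ≠ 0)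
    (hc : c ≠ ∞) :
    (atTop.liminf fun n : ℕ => (((n : ℝ)⁻¹ : ℝ) : EReal) * ENNReal.log (p n)) ≤
      atTop.liminf fun n : ℕ => (((n : ℝ)⁻¹ : ℝ) : EReal) * ENNReal.log (c * p n) := by
  obtain ⟨l, hl⟩ : ∃ l : ℝ, (l : EReal) = ENNReal.log c :=
    ⟨_, EReal.coe_toReal (by simpa using hc) (by simpa using hc₀)⟩
  have hlim : Tendsto (fun n : ℕ => (((n : ℝ)⁻¹ : ℝ) : EReal) * ENNReal.log c) atTop (𝓝 0) := by
    rw [← hl]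
    have := (tendsto_inv_atTop_nhds_zero_nat (𝕜 := ℝ)).mul_const l
    rw [zero_mul] at this
    exact_mod_cast (continuous_coe_real_ereal.tendsto 0).comp this
  have hadd := EReal.le_liminf_add (f := atTop)
    (u := fun n : ℕ => (((n : ℝ)⁻¹ : ℝ) : EReal) * ENNReal.log c)
    (v := fun n : ℕ => (((n : ℝ)⁻¹ : ℝ) : EReal) * ENNReal.log (p n))
  rw [hlim.liminf_eq, zero_add] at hadd
  refine hadd.trans_eq (congrArg (fun f => liminf f atTop) (funext fun n => ?_))
  rw [Pi.add_apply, ENNReal.log_mul_add,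
    EReal.left_distrib_of_nonneg_of_ne_top (EReal.coe_nonneg.mpr (by positivity))
      (EReal.coe_ne_top _)]

/-- Scalars close to `1` move points close to `x` only slightly. -/
theorem eventually_mul_mem_ball_of_tendsto_one {a : ℕ → ℝ} (ha : Tendsto a atTop (𝓝 1))
    (x : ℝ) {ε : ℝ} (hε : 0 < ε) :
    ∀ᶠ n in atTop, ∀ b ∈ Icc (a n) 1, ∀ y ∈ Metric.ball x ε, b * y ∈ Metric.ball x (2 * ε) := by
  have hlim : Tendsto (fun n => (1 - a n) * (|x| + ε)) atTop (𝓝 0) := by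
    simpa using (ha.const_sub 1).mul_const (|x| + ε)
  filter_upwards [hlim.eventually_lt_const hε] with n hn b hb y hy
  rw [Metric.mem_ball, Real.dist_eq] at hy ⊢
  have hy' : |y| ≤ |x| + ε := by
    have := abs_sub_abs_le_abs_sub y x
    linarith
  calc |b * y - x| = |(y - x) - (1 - b) * y| := by ring_nf
    _ ≤ |y - x| + |(1 - b) * y| := abs_sub _ _
    _ = |y - x| + (1 - b) * |y| := by rw [abs_mul, abs_of_nonneg (sub_nonneg.mpr hb.2)]
    _ ≤ |y - x| + (1 - a n) * (|x| + ε) := by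
      have h₁ : 1 - b ≤ 1 - a n := by linarith [hb.1]
      have h₂ : 0 ≤ 1 - a n := by linarith [hb.1, hb.2]
      gcongr
    _ < 2 * ε := by linarith

/-- Multiplying by an independent `U^{1/n}` factor preserves the LDP when the
rate function is good, quasiconvex and symmetric. -/
theorem statement13
    {Ω : Type*} [MeasurableSpace Ω] (P : Measure Ω) [IsProbabilityMeasure P]
    (ξ : ℕ → Ω → ℝ) (I : ℝ → EReal)
    (hLDP : IsLDP P ξ (fun n => (n : ℝ)) I)
    (hIpos : ∀ w : ℝ, 0 ≤ I w)
    (hgood : HasCompactSublevels I)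
    (hquasi : QuasiconvexRate I)
    (hsymm : SymmetricRate I)
    (U : Ω → ℝ) (hUmeas : Measurable U)
    (hU : Measure.map U P = volume.restrict (Set.Icc (0:ℝ) 1))
    (hIndep : ∀ n, IndepFun U (ξ n) P) :
    IsLDP P (fun n ω => (U ω) ^ ((n : ℝ)⁻¹) * ξ n ω) (fun n => (n : ℝ)) I := by
  have hUmem : ∀ᵐ ω ∂P, U ω ∈ Icc (0 : ℝ) 1 := by
    have : ∀ᵐ u ∂(Measure.map U P), u ∈ Icc (0 : ℝ) 1 := by
      rw [hU]
      exact ae_restrict_mem measurableSet_Icc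
    exact ae_of_ae_map hUmeas.aemeasurable this
  refine ⟨hLDP.1, fun Γ _ => ⟨?_, hLDP.limsup_mul_le hquasi hsymm (fun n => ?_) isClosed_closure⟩⟩
  swap
  · filter_upwards [hUmem] with ω hω
    exact ⟨Real.rpow_nonneg hω.1 _, Real.rpow_le_one hω.1 hω.2 (by positivity)⟩
  rw [EReal.neg_le]
  refine le_iInf₂ fun x hx => ?_
  rw [EReal.neg_le]
  obtain ⟨ε, hε, hball⟩ : ∃ ε > 0, Metric.ball x (2 * ε) ⊆ interior Γ := by
    obtain ⟨δ, hδ, h⟩ := Metric.isOpen_iff.mp isOpen_interior x hx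
    exact ⟨δ / 2, by positivity, by rwa [mul_div_cancel₀ δ two_ne_zero]⟩
  have hlower := (hLDP.2 _ (measurableSet_ball (x := x) (ε := ε))).1
  rw [Metric.isOpen_ball.interior_eq] at hlower
  have hUhalf : P (U ⁻¹' Icc (1 / 2) 1) = ENNReal.ofReal (1 / 2) := by
    rw [← Measure.map_apply hUmeas measurableSet_Icc, hU,
      Measure.restrict_apply measurableSet_Icc,
      inter_eq_left.mpr (Icc_subset_Icc_left (by norm_num)), Real.volume_Icc]
    norm_num
  have ha : Tendsto (fun n : ℕ => (1 / 2 : ℝ) ^ ((n : ℝ)⁻¹)) atTop (𝓝 1) := by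
    simpa [Function.comp_def] using
      (Real.continuousAt_const_rpow (a := (1 / 2 : ℝ)) (by norm_num)).tendsto.comp
        (tendsto_inv_atTop_nhds_zero_nat (𝕜 := ℝ))
  calc -I x ≤ -(⨅ y ∈ Metric.ball x ε, I y) :=
        EReal.neg_le_neg_iff.mpr (iInf₂_le x (Metric.mem_ball_self hε))
    _ ≤ _ := hlower
    _ ≤ _ := liminf_log_le_liminf_log_const_mul _ (c := ENNReal.ofReal (1 / 2)) (by simp) (by simp)
    _ ≤ _ := liminf_le_liminf ?_
  filter_upwards [eventually_mul_mem_ball_of_tendsto_one ha x hε] with n hn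
  refine mul_le_mul_of_nonneg_left (ENNReal.log_monotone ?_)
    (EReal.coe_nonneg.mpr (by positivity))
  have hprod := (hIndep n).measure_inter_preimage_eq_mul (Icc (1 / 2) 1) (Metric.ball x ε)
    measurableSet_Icc measurableSet_ball
  rw [hUhalf] at hprod
  refine hprod.ge.trans (measure_mono fun ω hω => hball (hn _ ⟨?_, ?_⟩ _ hω.2))
  · exact Real.rpow_le_rpow (by norm_num) hω.1.1 (by positivity)
  · exact Real.rpow_le_one ((by norm_num : (0 : ℝ) ≤ 1 / 2).trans hω.1.1) hω.1.2 (by positivity)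
end
end

section
/- Fix p ∈ [1,∞) and set r_p := 2p/(2+p). Let Y and Z be independent random variables with Y distributed according to μ_p and Z standard Gaussian. Then lim_{t→∞} t^{−r_p} log ℙ(Y Z ≥ t) = −1/r_p. -/
open MeasureTheory Filter Topology Set ProbabilityTheory
open scoped ENNReal NNReal

noncomputable section

open LDP

namespace LDP

theorem measurable_muP_density (p : ℝ) : Measurable fun y : ℝ =>
    ENNReal.ofReal ((2 * p ^ (1/p) * Real.Gamma (1 + 1/p))⁻¹ * Real.exp (-(|y| ^ p) / p)) := by
  fun_prop

theorem muP_const_pos {p : ℝ} (hp : 0 < p) :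
    0 < (2 * p ^ (1/p) * Real.Gamma (1 + 1/p))⁻¹ := by
  have : 0 < Real.Gamma (1 + 1/p) := Real.Gamma_pos_of_pos (by positivity)
  positivity

theorem integrable_exp_neg_mul_abs_rpow {p b : ℝ} (hp : 0 < p) (hb : 0 < b) :
    Integrable fun y : ℝ => Real.exp (-b * |y| ^ p) := by
  have h := integrableOn_rpow_mul_exp_neg_mul_rpow (s := 0) (by norm_num) hp hb
  have := (integrable_fun_norm_addHaar (E := ℝ) volume
    (f := fun x : ℝ => Real.exp (-b * x ^ p))).2 (by simpa using h)
  simpa using this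

/-- The measure `μ_p` has finite exponential moments of `|y|^p / p` of every order `a < 1`. -/
theorem lintegral_exp_muP_lt_top {p a : ℝ} (hp : 0 < p) (ha : a < 1) :
    ∫⁻ y, ENNReal.ofReal (Real.exp (a * (|y| ^ p / p))) ∂(muP p) < ⊤ := by
  rw [muP, lintegral_withDensity_eq_lintegral_mul _ (measurable_muP_density p) (by fun_prop)]
  have hb : 0 < (1 - a) / p := div_pos (by linarith) hp
  have hint := ((integrable_exp_neg_mul_abs_rpow hp hb).const_mul
    (2 * p ^ (1/p) * Real.Gamma (1 + 1/p))⁻¹).lintegral_lt_top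
  refine lt_of_le_of_lt (lintegral_mono fun y => le_of_eq ?_) hint
  rw [Pi.mul_apply, ← ENNReal.ofReal_mul (mul_pos (muP_const_pos hp) (Real.exp_pos _)).le,
    mul_assoc, ← Real.exp_add]
  congr 3
  ring

/-- Lower bound for the upper tail of `μ_p`, by integrating the density over `[y, y+1]`. -/
theorem le_muP_Ici {p y : ℝ} (hp : 0 < p) (hy : 0 ≤ y) :
    ENNReal.ofReal ((2 * p ^ (1/p) * Real.Gamma (1 + 1/p))⁻¹ * Real.exp (-((y + 1) ^ p) / p))
      ≤ muP p (Ici y) := by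
  refine le_trans ?_ (measure_mono (Icc_subset_Ici_self : Icc y (y + 1) ⊆ Ici y))
  rw [muP, withDensity_apply _ measurableSet_Icc]
  calc _ = ∫⁻ _ in Icc y (y + 1), ENNReal.ofReal
        ((2 * p ^ (1/p) * Real.Gamma (1 + 1/p))⁻¹ * Real.exp (-((y + 1) ^ p) / p)) := by simp
    _ ≤ _ := by
      refine setLIntegral_mono (measurable_muP_density p) fun x hx => ?_
      have hx0 : 0 ≤ x := hy.trans hx.1
      have := (muP_const_pos hp).le
      rw [abs_of_nonneg hx0]
      have hx1 := hx.2
      gcongr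

/-- Young's inequality in the form of a lower bound for the joint rate. -/
theorem abs_mul_rpow_div_le {p r : ℝ} (hp : 0 < p) (hr : 0 < r) (hpr : 1 / r = 1 / p + 1 / 2)
    (y z : ℝ) : |y * z| ^ r / r ≤ |y| ^ p / p + |z| ^ (2:ℝ) / 2 := by
  have h1 : (p / r)⁻¹ + (2 / r)⁻¹ = 1 := by
    field_simp at hpr ⊢
    linarith
  have hconj : (p / r).HolderConjugate (2 / r) := by
    refine Real.holderConjugate_iff.2 ⟨?_, h1⟩
    have h2 : 0 < (2 / r)⁻¹ := by positivity
    exact (inv_lt_one₀ (by positivity)).1 (by linarith)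
  have h := Real.young_inequality_of_nonneg (a := |y| ^ r) (b := |z| ^ r)
    (by positivity) (by positivity) hconj
  rw [← Real.rpow_mul (abs_nonneg _), ← Real.rpow_mul (abs_nonneg _),
    mul_div_cancel₀ _ hr.ne', mul_div_cancel₀ _ hr.ne',
    ← Real.mul_rpow (abs_nonneg _) (abs_nonneg _), ← abs_mul] at h
  rw [div_le_iff₀ hr]
  calc _ ≤ _ := h
    _ = _ := by field_simp

theorem tendsto_rpow_neg_mul_rpow_add_one {r q : ℝ} (hr : 0 < r) (hq : 0 < q) :
    Tendsto (fun t : ℝ => t ^ (-r) * (t ^ (r / q) + 1) ^ q) atTop (𝓝 1) := by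
  have h : Tendsto (fun t : ℝ => (1 + t ^ (-(r / q))) ^ q) atTop (𝓝 1) := by
    have := ((tendsto_rpow_neg_atTop (div_pos hr hq)).const_add 1).rpow_const
      (p := q) (Or.inr hq.le)
    simpa using this
  refine h.congr' ?_
  filter_upwards [eventually_gt_atTop 0] with t ht
  have hs : 0 < t ^ (r / q) := Real.rpow_pos_of_pos ht _
  have h2 : t ^ (-r) = (t ^ (-(r / q))) ^ q := by
    rw [← Real.rpow_mul ht.le]
    congr 1
    field_simp
  rw [h2, ← Real.mul_rpow (by positivity) (by positivity), mul_add, ← Real.rpow_add ht]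
  simp

/-- Squeeze argument turning exponential upper and lower bounds for a tail function into
logarithmic asymptotics. -/
theorem tendsto_rpow_neg_mul_log_of_bounds {p q r c : ℝ} {F : ℝ → ℝ} (hp : 0 < p) (hq : 0 < q)
    (hr : 0 < r) (hpr : 1 / r = 1 / p + 1 / q) (hc : 0 < c)
    (hlower : ∀ t > 0, c * Real.exp (-((t ^ (r / p) + 1) ^ p) / p
      + -((t ^ (r / q) + 1) ^ q) / q) ≤ F t)
    (hupper : ∀ a, 0 < a → a < 1 → ∃ C > 0, ∀ t > 0, F t ≤ C * Real.exp (-(a * (t ^ r / r)))) :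
    Tendsto (fun t : ℝ => t ^ (-r) * Real.log (F t)) atTop (𝓝 (-(1 / r))) := by
  have hneg := tendsto_rpow_neg_atTop hr
  have hpos : ∀ t > 0, 0 < F t := fun t ht => lt_of_lt_of_le (by positivity) (hlower t ht)
  refine tendsto_order.2 ⟨fun b hb => ?_, fun b hb => ?_⟩
  · have hlim : Tendsto (fun t : ℝ => t ^ (-r) * Real.log c
        - (t ^ (-r) * (t ^ (r / p) + 1) ^ p) / p
        - (t ^ (-r) * (t ^ (r / q) + 1) ^ q) / q) atTop (𝓝 (-(1 / r))) := by
      have := ((hneg.mul_const (Real.log c)).sub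
        ((tendsto_rpow_neg_mul_rpow_add_one hr hp).div_const p)).sub
        ((tendsto_rpow_neg_mul_rpow_add_one hr hq).div_const q)
      convert this using 2
      rw [hpr]
      ring
    filter_upwards [hlim.eventually_const_lt hb, eventually_gt_atTop 0] with t ht ht0
    refine ht.trans_le ?_
    have hlog := Real.log_le_log (by positivity) (hlower t ht0)
    rw [Real.log_mul hc.ne' (Real.exp_pos _).ne', Real.log_exp] at hlog
    calc _ = t ^ (-r) * (Real.log c + (-((t ^ (r / p) + 1) ^ p) / p
      + -((t ^ (r / q) + 1) ^ q) / q)) := by ring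
      _ ≤ _ := by gcongr
  · obtain ⟨a, ha, ha1⟩ : ∃ a, max 0 (-(b * r)) < a ∧ a < 1 := by
      refine exists_between (max_lt one_pos ?_)
      have := mul_lt_mul_of_pos_right hb hr
      field_simp at this
      linarith
    have ha0 : 0 < a := (le_max_left _ _).trans_lt ha
    have hab : -(a / r) < b := by
      have := (le_max_right _ _).trans_lt ha
      rw [neg_lt, lt_div_iff₀ hr]
      linarith
    obtain ⟨C, hC, hF⟩ := hupper a ha0 ha1
    have hlim : Tendsto (fun t : ℝ => t ^ (-r) * Real.log C - a / r) atTop (𝓝 (-(a / r))) := by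
      have := (hneg.mul_const (Real.log C)).sub_const (a / r)
      simpa using this
    filter_upwards [hlim.eventually_lt_const hab, eventually_gt_atTop 0] with t ht ht0
    refine lt_of_le_of_lt ?_ ht
    have hlog := Real.log_le_log (hpos t ht0) (hF t ht0)
    rw [Real.log_mul hC.ne' (Real.exp_pos _).ne', Real.log_exp] at hlog
    calc _ ≤ t ^ (-r) * (Real.log C + -(a * (t ^ r / r))) := by gcongr
      _ = t ^ (-r) * Real.log C - a * (t ^ (-r) * t ^ r) / r := by ring
      _ = _ := by rw [← Real.rpow_add ht0]; simp

section Product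

variable {Ω : Type*} [MeasurableSpace Ω] {P : Measure Ω}
  {Y Z : Ω → ℝ} {p r : ℝ}

theorem le_prob_le_mul [IsFiniteMeasure P] (hp : 0 < p) (hr : 0 < r) (hpr : 1 / r = 1 / p + 1 / 2)
    (hYmeas : Measurable Y) (hZmeas : Measurable Z)
    (hY : Measure.map Y P = muP p) (hZ : Measure.map Z P = muP 2) (hIndep : IndepFun Y Z P)
    {t : ℝ} (ht : 0 < t) :
    ((2 * p ^ (1/p) * Real.Gamma (1 + 1/p))⁻¹
      * (2 * (2:ℝ) ^ ((1:ℝ)/2) * Real.Gamma (1 + 1/2))⁻¹) *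
      Real.exp (-((t ^ (r / p) + 1) ^ p) / p + -((t ^ (r / 2) + 1) ^ (2:ℝ)) / 2)
      ≤ (P {ω | t ≤ Y ω * Z ω}).toReal := by
  have hy : 0 ≤ t ^ (r / p) := by positivity
  have hz : 0 ≤ t ^ (r / 2) := by positivity
  have hyz : t ^ (r / p) * t ^ (r / 2) = t := by
    rw [← Real.rpow_add ht, show r / p + r / 2 = r * (1 / p + 1 / 2) by ring, ← hpr,
      mul_one_div_cancel hr.ne', Real.rpow_one]
  have hsub : Y ⁻¹' Ici (t ^ (r / p)) ∩ Z ⁻¹' Ici (t ^ (r / 2)) ⊆ {ω | t ≤ Y ω * Z ω} := by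
    rintro ω ⟨h1, h2⟩
    calc t = _ := hyz.symm
      _ ≤ Y ω * Z ω := mul_le_mul h1 h2 hz (hy.trans h1)
  have h1 := le_muP_Ici hp hy
  have h2 := le_muP_Ici two_pos hz
  rw [← hY, Measure.map_apply hYmeas measurableSet_Ici] at h1
  rw [← hZ, Measure.map_apply hZmeas measurableSet_Ici] at h2
  have c1 := muP_const_pos hp
  have c2 := muP_const_pos two_pos
  rw [← ENNReal.ofReal_le_iff_le_toReal (measure_ne_top _ _)]
  refine le_trans ?_ (measure_mono hsub)
  rw [hIndep.measure_inter_preimage_eq_mul _ _ measurableSet_Ici measurableSet_Ici]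
  refine le_trans (le_of_eq ?_) (mul_le_mul' h1 h2)
  rw [← ENNReal.ofReal_mul (by positivity), Real.exp_add]
  congr 1
  ring

theorem exists_prob_le_mul_le (hp : 0 < p) (hr : 0 < r) (hpr : 1 / r = 1 / p + 1 / 2)
    (hYmeas : Measurable Y) (hZmeas : Measurable Z)
    (hY : Measure.map Y P = muP p) (hZ : Measure.map Z P = muP 2) (hIndep : IndepFun Y Z P)
    {a : ℝ} (ha0 : 0 < a) (ha1 : a < 1) :
    ∃ C > 0, ∀ t > 0,
      (P {ω | t ≤ Y ω * Z ω}).toReal ≤ C * Real.exp (-(a * (t ^ r / r))) := by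
  let g : ℝ → ℝ → ℝ≥0∞ := fun q x => ENNReal.ofReal (Real.exp (a * (|x| ^ q / q)))
  have hg : ∀ q, Measurable (g q) := fun q => by fun_prop
  let I : ℝ≥0∞ := ∫⁻ ω, g p (Y ω) * g 2 (Z ω) ∂P
  have hI : I < ⊤ := by
    have : I = (∫⁻ ω, g p (Y ω) ∂P) * ∫⁻ ω, g 2 (Z ω) ∂P :=
      lintegral_mul_eq_lintegral_mul_lintegral_of_indepFun ((hg p).comp hYmeas)
        ((hg 2).comp hZmeas) (hIndep.comp (hg p) (hg 2))
    rw [this, ← lintegral_map (hg p) hYmeas, ← lintegral_map (hg 2) hZmeas, hY, hZ]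
    exact ENNReal.mul_lt_top (lintegral_exp_muP_lt_top hp ha1)
      (lintegral_exp_muP_lt_top two_pos ha1)
  refine ⟨I.toReal + 1, by positivity, fun t ht => ?_⟩
  have hsub : {ω | t ≤ Y ω * Z ω} ⊆
      {ω | ENNReal.ofReal (Real.exp (a * (t ^ r / r))) ≤ g p (Y ω) * g 2 (Z ω)} := by
    intro ω hω
    have hω' : t ≤ |Y ω * Z ω| := le_trans hω (le_abs_self _)
    simp only [mem_ofPred_eq, g]
    rw [← ENNReal.ofReal_mul (Real.exp_pos _).le, ← Real.exp_add, ← mul_add]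
    have h1 : t ^ r / r ≤ |Y ω * Z ω| ^ r / r := by gcongr
    have h2 := h1.trans (abs_mul_rpow_div_le hp hr hpr (Y ω) (Z ω))
    gcongr
  have hmarkov := mul_meas_ge_le_lintegral (μ := P)
    (((hg p).comp hYmeas).mul ((hg 2).comp hZmeas)) (ENNReal.ofReal (Real.exp (a * (t ^ r / r))))
  have hle : ENNReal.ofReal (Real.exp (a * (t ^ r / r))) * P {ω | t ≤ Y ω * Z ω} ≤ I :=
    le_trans (mul_le_mul_right (measure_mono hsub) _) hmarkov
  have hreal := ENNReal.toReal_mono hI.ne hle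
  rw [ENNReal.toReal_mul, ENNReal.toReal_ofReal (Real.exp_pos _).le] at hreal
  rw [Real.exp_neg, ← div_eq_mul_inv, le_div_iff₀ (Real.exp_pos _)]
  linarith

end Product

end LDP

/-- Tail asymptotics of the product `Y Z`, `Y ∼ μ_p`, `Z` standard Gaussian. -/
theorem statement14
    (p : ℝ) (hp : 1 ≤ p)
    {Ω : Type*} [MeasurableSpace Ω] (P : Measure Ω) [IsProbabilityMeasure P]
    (Y Z : Ω → ℝ) (hYmeas : Measurable Y) (hZmeas : Measurable Z)
    (hY : Measure.map Y P = muP p) (hZ : Measure.map Z P = muP 2)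
    (hIndep : IndepFun Y Z P) :
    Tendsto (fun t : ℝ => t ^ (-(2*p/(2+p))) * Real.log ((P {ω | t ≤ Y ω * Z ω}).toReal))
      atTop (nhds (-(1 / (2*p/(2+p))))) := by
  have hp0 : 0 < p := by linarith
  have hr : 0 < 2*p/(2+p) := by positivity
  have hpr : 1 / (2*p/(2+p)) = 1 / p + 1 / 2 := by
    field_simp
  exact tendsto_rpow_neg_mul_log_of_bounds hp0 two_pos hr hpr
    (mul_pos (muP_const_pos hp0) (muP_const_pos two_pos))
    (fun t ht => le_prob_le_mul hp0 hr hpr hYmeas hZmeas hY hZ hIndep ht)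
    (fun a ha0 ha1 => exists_prob_le_mul_le hp0 hr hpr hYmeas hZmeas hY hZ hIndep ha0 ha1)
end
end

section
/- Fix p ∈ [1,∞). For every t₁ ∈ ℝ and every t₂ < 1/p, Λ_p(t₁,t₂) = −(1/p) log(1 − p t₂) + log M_{μ_p}( t₁ (1 − p t₂)^{−1/p} ). -/
open MeasureTheory Filter Topology Set ProbabilityTheory
open scoped ENNReal NNReal

noncomputable section

open LDP

/-- Scaling of the Lebesgue integral of a nonnegative function on `ℝ`. -/
theorem lintegral_eq_mul_lintegral_comp_mul_left (f : ℝ → ℝ≥0∞) {s : ℝ} (hs : 0 < s) :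
    ∫⁻ y, f y = ENNReal.ofReal s * ∫⁻ y, f (s * y) := by
  conv_lhs => rw [← Real.smul_map_volume_mul_left hs.ne', lintegral_smul_measure,
    (measurableEmbedding_mulLeft₀ hs.ne').lintegral_map, abs_of_pos hs, smul_eq_mul]

theorem lintegral_muP (p : ℝ) {g : ℝ → ℝ≥0∞} (hg : Measurable g) :
    ∫⁻ y, g y ∂(muP p) = ∫⁻ y, ENNReal.ofReal
      ((2 * p ^ (1/p) * Real.Gamma (1 + 1/p))⁻¹ * Real.exp (-(|y| ^ p) / p)) * g y :=
  lintegral_withDensity_eq_lintegral_mul _ (by fun_prop) hg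

theorem ofReal_mul_exp_mul_ofReal_exp (c u v : ℝ) :
    ENNReal.ofReal (c * Real.exp u) * ENNReal.ofReal (Real.exp v) =
      ENNReal.ofReal (c * Real.exp (u + v)) := by
  rw [← ENNReal.ofReal_mul' (Real.exp_pos v).le, mul_assoc, ← Real.exp_add]

/-- Explicit decomposition of `Λ_p`. -/
theorem statement15 (p : ℝ) (hp : 1 ≤ p) (t₁ t₂ : ℝ) (ht : t₂ < 1/p) :
    LamP p (t₁, t₂) =
      ((-(1/p) * Real.log (1 - p * t₂) : ℝ) : EReal)
        + logM (muP p) (t₁ * (1 - p * t₂) ^ (-(1:ℝ)/p)) := by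
  have hp0 : 0 < p := by linarith
  have ha : 0 < 1 - p * t₂ := by
    have := (lt_div_iff₀ hp0).mp ht
    linarith
  set s : ℝ := (1 - p * t₂) ^ (-(1:ℝ)/p) with hs_def
  have hs : 0 < s := Real.rpow_pos_of_pos ha _
  have hlog : -(1/p) * Real.log (1 - p * t₂) = Real.log s := by
    rw [hs_def, Real.log_rpow ha, neg_div]
  have hsp : s ^ p = (1 - p * t₂)⁻¹ := by
    rw [hs_def, ← Real.rpow_mul ha.le, div_mul_cancel₀ _ hp0.ne', Real.rpow_neg_one]
  rw [hlog, ← ENNReal.log_ofReal_of_pos hs, LamP, logM, ← ENNReal.log_mul_add,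
    lintegral_muP p (by fun_prop), lintegral_muP p (by fun_prop),
    lintegral_eq_mul_lintegral_comp_mul_left _ hs]
  congr 3 with y
  rw [ofReal_mul_exp_mul_ofReal_exp, ofReal_mul_exp_mul_ofReal_exp, abs_mul, abs_of_pos hs,
    Real.mul_rpow hs.le (abs_nonneg y), hsp]
  congr 3
  field_simp
  ring
end
end
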